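/- arXiv:2302.01869 — 4 statements merged into one kernel-verified Lean document; each statement's English description precedes it below -/
import Mathlib

section
/- For every integer n > 1, every admissible α, and every t ∈ (0,1), every integer N > max{ n/(4t)^{n−1}, n } satisfies (1/N)·‖[X, U_{t,n}^N]‖ ≤ (4t)^n. -/
noncomputable section

abbrev Hqw : Type := lp (fun _ : ℤ => ℂ) 2
abbrev Op : Type := Hqw →L[ℂ] Hqw

noncomputable def δ (j : ℤ) : Hqw := lp.single 2 j 1

def coord (ψ : Hqw) (i : ℤ) : ℂ := ψ i

/-- `B δ_j = δ_{j-1} - δ_{j+1}`. -/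
def IsB (B : Op) : Prop := ∀ j : ℤ, B (δ j) = δ (j - 1) - δ (j + 1)

/-- `C δ_{2j} = δ_{2j+2}`, `C δ_{2j+1} = δ_{2j-1}`. -/
def IsC (C : Op) : Prop :=
  ∀ j : ℤ, C (δ (2 * j)) = δ (2 * j + 2) ∧ C (δ (2 * j + 1)) = δ (2 * j - 1)

/-- the position sequence: `x_{2j} = x_{2j+1} = |j|`. -/
def IsPos (x : ℤ → ℝ) : Prop :=
  ∀ j : ℤ, x (2 * j) = |(j : ℝ)| ∧ x (2 * j + 1) = |(j : ℝ)|

/-- `K` is the commutator `[X, A]`, i.e. `⟨δ_i, K δ_j⟩ = (x_i - x_j) ⟨δ_i, A δ_j⟩`. -/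
def IsXComm (x : ℤ → ℝ) (A K : Op) : Prop :=
  ∀ i j : ℤ, coord (K (δ j)) i = ((x i - x j : ℝ) : ℂ) * coord (A (δ j)) i

/-- a local field: a diagonal unitary `D δ_j = e^{iθ_j} δ_j`. -/
def IsLocalField (D : Op) : Prop :=
  ∃ θ : ℤ → ℝ, ∀ j : ℤ, D (δ j) = Complex.exp ((θ j : ℂ) * Complex.I) • δ j

/-- `U_t = r² I + r t B + t² C` with `r = √(1 - t²)`. -/
def Ut (t : ℝ) (B C : Op) : Op :=
  (((Real.sqrt (1 - t ^ 2)) ^ 2 : ℝ) : ℂ) • (1 : Op) +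
    ((Real.sqrt (1 - t ^ 2) * t : ℝ) : ℂ) • B + ((t ^ 2 : ℝ) : ℂ) • C

/-- `⟨X⟩_ψ = Σ_j x_j |⟨δ_j, ψ⟩|²`. -/
def Xexp (x : ℤ → ℝ) (ψ : Hqw) : ℝ := ∑' j : ℤ, x j * ‖coord ψ j‖ ^ 2

/-- a unit vector supported on `span{δ₀, δ₁}`. -/
def IsInit (Ψ : Hqw) : Prop := ‖Ψ‖ = 1 ∧ ∃ a b : ℂ, Ψ = a • δ 0 + b • δ 1

/-- `α = e^{2πik/n}` with `k ∈ ℤ⁺`, `gcd(k,n) = 1`, `α ≠ 1`. -/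
def IsAdmissible (n : ℕ) (α : ℂ) : Prop :=
  α ≠ 1 ∧ ∃ k : ℕ, 0 < k ∧ Nat.gcd k n = 1 ∧
    α = Complex.exp (((2 * Real.pi * k / n : ℝ) : ℂ) * Complex.I)

/-- the `n`-periodic field `D_n δ_j = α^j δ_j`. -/
def IsDn (α : ℂ) (D : Op) : Prop := ∀ j : ℤ, D (δ j) = α ^ j • δ j

/-- `B^{(j)} = D_n^j B D_n^{-j}`, explicitly `B^{(j)} δ_i = α^{-j} δ_{i-1} - α^{j} δ_{i+1}`. -/
def IsBj (α : ℂ) (j : ℤ) (Bj : Op) : Prop :=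
  ∀ i : ℤ, Bj (δ i) = α ^ (-j) • δ (i - 1) - α ^ j • δ (i + 1)

/-- `C^{(j)} = D_n^j C D_n^{-j}`, explicitly `C^{(j)} δ_{2i} = α^{2j} δ_{2i+2}`,
`C^{(j)} δ_{2i+1} = α^{-2j} δ_{2i-1}`. -/
def IsCj (α : ℂ) (j : ℤ) (Cj : Op) : Prop :=
  ∀ i : ℤ, Cj (δ (2 * i)) = α ^ (2 * j) • δ (2 * i + 2) ∧
    Cj (δ (2 * i + 1)) = α ^ (-(2 * j)) • δ (2 * i - 1)

-- the elementary symmetric polynomial of operators `S^{ℓ,m}_{[a, n-1]}`: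
-- sum over `a ≤ j₁ < … < j_ℓ ≤ n-1` and `η ∈ {0,1}^ℓ` with `|η| = m` of the ordered
-- products `A_{η₁}^{(j₁)} ⋯ A_{η_ℓ}^{(j_ℓ)}`, where `A_1 = C`, `A_0 = B`.
open Classical in
noncomputable def Sop (Bf Cf : ℤ → Op) (a n ℓ m : ℕ) : Op :=
  ∑ p : (Fin ℓ → Fin n) × (Fin ℓ → Bool),
    if StrictMono p.1 ∧ (∀ k, a ≤ (p.1 k : ℕ)) ∧
        (Finset.univ.filter fun k => p.2 k = true).card = m then
      (List.ofFn fun k : Fin ℓ =>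
        if p.2 k = true then Cf ((p.1 k : ℕ) : ℤ) else Bf ((p.1 k : ℕ) : ℤ)).prod
    else 0

/-! ### Matrix entries -/

def ent (A : Op) (i j : ℤ) : ℂ := coord (A (δ j)) i

lemma coord_delta (i j : ℤ) : coord (δ j) i = if i = j then 1 else 0 := by
  unfold coord δ
  rw [lp.single_apply]
  by_cases h : i = j
  · subst h; simp
  · simp [h]

lemma coord_add (a b : Hqw) (i : ℤ) : coord (a + b) i = coord a i + coord b i := rfl
lemma coord_sub (a b : Hqw) (i : ℤ) : coord (a - b) i = coord a i - coord b i := rfl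
lemma coord_smul (c : ℂ) (b : Hqw) (i : ℤ) : coord (c • b) i = c * coord b i := rfl
lemma coord_zero (i : ℤ) : coord 0 i = 0 := rfl

lemma hasSum_delta (ψ : Hqw) : HasSum (fun k => coord ψ k • δ k) ψ := by
  have h := lp.hasSum_single (E := fun _ : ℤ => ℂ) (p := 2) (by simp) ψ
  convert h using 2 with k
  unfold δ coord
  rw [← lp.single_smul]
  simp

lemma hasSum_coord {f : ℤ → Hqw} {ψ : Hqw} (h : HasSum f ψ) (i : ℤ) :
    HasSum (fun k => coord (f k) i) (coord ψ i) := by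
  have h2 := (innerSL ℂ (δ i)).hasSum h
  have key : ∀ φ : Hqw, innerSL ℂ (δ i) φ = coord φ i := by
    intro φ
    simp [δ, coord, lp.inner_single_left]
  simpa [key] using h2

lemma hasSum_ent_mul (A A' : Op) (i j : ℤ) :
    HasSum (fun k => ent A i k * ent A' k j) (ent (A * A') i j) := by
  have h := hasSum_coord (A.hasSum (hasSum_delta (A' (δ j)))) i
  have e : (fun k => ent A i k * ent A' k j) =
      fun k => coord (A (coord (A' (δ j)) k • δ k)) i := by
    funext k
    simp [ent, coord_smul, mul_comm]
  rw [e]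
  exact h

lemma op_ext {A A' : Op} (h : ∀ j, A (δ j) = A' (δ j)) : A = A' := by
  ext1 ψ
  have h1 := A.hasSum (hasSum_delta ψ)
  have h2 := A'.hasSum (hasSum_delta ψ)
  refine h1.unique ?_
  convert h2 using 2 with k
  simp [h]

lemma vec_ext {a b : Hqw} (h : ∀ i, coord a i = coord b i) : a = b := by
  apply lp.ext
  funext i
  exact h i

lemma ent_ext {A A' : Op} (h : ∀ i j, ent A i j = ent A' i j) : A = A' :=
  op_ext fun j => vec_ext fun i => h i j

lemma ent_add (A A' : Op) (i j : ℤ) : ent (A + A') i j = ent A i j + ent A' i j := rfl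
lemma ent_smul (c : ℂ) (A : Op) (i j : ℤ) : ent (c • A) i j = c * ent A i j := rfl
lemma ent_zero (i j : ℤ) : ent 0 i j = 0 := rfl
lemma ent_one (i j : ℤ) : ent 1 i j = if i = j then 1 else 0 := coord_delta i j

lemma ent_sum {ι : Type*} (s : Finset ι) (f : ι → Op) (i j : ℤ) :
    ent (∑ a ∈ s, f a) i j = ∑ a ∈ s, ent (f a) i j := by
  classical
  induction s using Finset.induction_on with
  | empty => simp [ent_zero]
  | insert a s ha ih => simp [Finset.sum_insert ha, ent_add, ih]

/-! ### Weighted permutations -/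

lemma exists_wp (s : ℤ → ℂ) (hs : ∀ j, ‖s j‖ = 1) (σ : ℤ → ℤ) (hσ : Function.Injective σ) :
    ∃ L : Hqw →ₗᵢ[ℂ] Hqw, ∀ j, L (δ j) = s j • δ (σ j) := by
  have hnorm : ∀ j, ‖s j • δ (σ j)‖ = 1 := by
    intro j
    rw [norm_smul, hs, one_mul, δ, lp.norm_single (by simp)]
    simp
  have horth : Orthonormal ℂ (fun j => s j • δ (σ j)) := by
    refine ⟨hnorm, ?_⟩
    intro i j hij
    have h : σ j ≠ σ i := fun h => hij (hσ h).symm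
    simp only [inner_smul_left, inner_smul_right, δ, lp.inner_single_left]
    rw [lp.single_apply_ne _ _ _ h.symm]
    simp
  refine ⟨horth.orthogonalFamily.linearIsometry, fun j => ?_⟩
  rw [δ, OrthogonalFamily.linearIsometry_apply_single]
  simp

/-! ### Commutators -/

lemma IsXComm.uniq {x : ℤ → ℝ} {A K K' : Op} (h : IsXComm x A K) (h' : IsXComm x A K') :
    K = K' := ent_ext fun i j => (h i j).trans (h' i j).symm

lemma IsXComm.add {x : ℤ → ℝ} {A K A' K' : Op} (h : IsXComm x A K) (h' : IsXComm x A' K') :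
    IsXComm x (A + A') (K + K') := by
  intro i j
  have h1 := h i j
  have h2 := h' i j
  simp only [add_apply, coord_add, h1, h2]
  ring

lemma IsXComm.smul {x : ℤ → ℝ} {A K : Op} (c : ℂ) (h : IsXComm x A K) :
    IsXComm x (c • A) (c • K) := by
  intro i j
  have h1 := h i j
  simp only [smul_apply, coord_smul, h1]
  ring

lemma IsXComm.zero (x : ℤ → ℝ) : IsXComm x 0 0 := by
  intro i j
  simp [coord_zero]

lemma IsXComm.one (x : ℤ → ℝ) : IsXComm x 1 0 := by
  intro i j
  change (0 : ℂ) = _ * coord (δ j) i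
  rw [coord_delta]
  split_ifs with h
  · subst h; simp
  · simp

lemma IsXComm.sum {x : ℤ → ℝ} {ι : Type*} (s : Finset ι) (f g : ι → Op)
    (h : ∀ a ∈ s, IsXComm x (f a) (g a)) : IsXComm x (∑ a ∈ s, f a) (∑ a ∈ s, g a) := by
  classical
  induction s using Finset.induction_on with
  | empty => simpa using IsXComm.zero x
  | insert a s ha ih =>
    rw [Finset.sum_insert ha, Finset.sum_insert ha]
    exact (h a (by simp)).add (ih fun b hb => h b (by simp [hb]))

lemma IsXComm.mul {x : ℤ → ℝ} {A K A' K' : Op} (h : IsXComm x A K) (h' : IsXComm x A' K') :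
    IsXComm x (A * A') (K * A' + A * K') := by
  intro i j
  have h1 := (hasSum_ent_mul K A' i j).add (hasSum_ent_mul A K' i j)
  have h2 := (hasSum_ent_mul A A' i j).mul_left ((x i - x j : ℝ) : ℂ)
  refine h1.unique ?_
  have e : (fun k => ent K i k * ent A' k j + ent A i k * ent K' k j) =
      fun k => ((x i - x j : ℝ) : ℂ) * (ent A i k * ent A' k j) := by
   funext k
   have e1 : ent K i k = ((x i - x k : ℝ) : ℂ) * ent A i k := h i k
   have e2 : ent K' k j = ((x k - x j : ℝ) : ℂ) * ent A' k j := h' k j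
   rw [e1, e2]
   push_cast
   ring
  rw [e]
  exact h2

lemma norm_op_pow_le {A : Op} (hA : ‖A‖ ≤ 1) (m : ℕ) : ‖A ^ m‖ ≤ 1 := by
  induction m with
  | zero => exact ContinuousLinearMap.norm_id_le
  | succ m ih =>
    rw [pow_succ]
    exact (norm_mul_le _ _).trans (mul_le_one₀ ih (norm_nonneg _) hA)

lemma IsXComm.pow {x : ℤ → ℝ} {A K : Op} (h : IsXComm x A K) (hA : ‖A‖ ≤ 1) (m : ℕ) :
    ∃ K', IsXComm x (A ^ m) K' ∧ ‖K'‖ ≤ m * ‖K‖ := by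
  induction m with
  | zero => exact ⟨0, by simpa using IsXComm.one x, by simp⟩
  | succ m ih =>
    obtain ⟨K', h1, h2⟩ := ih
    refine ⟨K' * A + A ^ m * K, by rw [pow_succ]; exact h1.mul h, ?_⟩
    have hp : ‖A ^ m‖ ≤ 1 := norm_op_pow_le hA m
    calc ‖K' * A + A ^ m * K‖ ≤ ‖K'‖ * ‖A‖ + ‖A ^ m‖ * ‖K‖ :=
          (norm_add_le _ _).trans (add_le_add (norm_mul_le _ _) (norm_mul_le _ _))
      _ ≤ ‖K'‖ * 1 + 1 * ‖K‖ := by gcongr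
      _ ≤ (m + 1 : ℕ) * ‖K‖ := by push_cast; linarith

/-! ### Operator polynomials -/

open Polynomial in
/-- majorant bounds for an operator polynomial and its commutator -/
def Maj (x : ℤ → ℝ) (Q Q' : Polynomial Op) (a b : Polynomial ℝ) : Prop :=
  ∀ p, IsXComm x (Q.coeff p) (Q'.coeff p) ∧ ‖Q.coeff p‖ ≤ a.coeff p ∧ ‖Q'.coeff p‖ ≤ b.coeff p

lemma norm_coeff_mul_le {Q R : Polynomial Op} {a b : Polynomial ℝ}
    (h1 : ∀ p, ‖Q.coeff p‖ ≤ a.coeff p) (h2 : ∀ p, ‖R.coeff p‖ ≤ b.coeff p) (p : ℕ) :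
    ‖(Q * R).coeff p‖ ≤ (a * b).coeff p := by
  rw [Polynomial.coeff_mul, Polynomial.coeff_mul]
  refine (norm_sum_le _ _).trans (Finset.sum_le_sum fun y _ => ?_)
  refine (norm_mul_le _ _).trans ?_
  exact mul_le_mul (h1 _) (h2 _) (norm_nonneg _) ((norm_nonneg _).trans (h1 _))

lemma Maj.mul {x : ℤ → ℝ} {Q Q' R R' : Polynomial Op} {a b c d : Polynomial ℝ}
    (h : Maj x Q Q' a b) (h' : Maj x R R' c d) :
    Maj x (Q * R) (Q' * R + Q * R') (a * c) (b * c + a * d) := by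
  intro p
  refine ⟨?_, norm_coeff_mul_le (fun p => (h p).2.1) (fun p => (h' p).2.1) p, ?_⟩
  · simp only [Polynomial.coeff_add, Polynomial.coeff_mul, ← Finset.sum_add_distrib]
    exact IsXComm.sum _ _ _ fun y _ => (h _).1.mul (h' _).1
  · rw [Polynomial.coeff_add, Polynomial.coeff_add]
    exact (norm_add_le _ _).trans (add_le_add
      (norm_coeff_mul_le (fun p => (h p).2.2) (fun p => (h' p).2.1) p)
      (norm_coeff_mul_le (fun p => (h p).2.1) (fun p => (h' p).2.2) p))

lemma Maj.pow {x : ℤ → ℝ} {Q Q' : Polynomial Op} {a b : Polynomial ℝ}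
    (h : Maj x Q Q' a b) (m : ℕ) :
    ∃ R, Maj x (Q ^ (m + 1)) R (a ^ (m + 1)) ((m + 1 : ℝ) • (b * a ^ m)) := by
  induction m with
  | zero => exact ⟨Q', by simpa using h⟩
  | succ m ih =>
    obtain ⟨R, hR⟩ := ih
    have := hR.mul h
    rw [← pow_succ, ← pow_succ] at this
    refine ⟨R * Q + Q ^ (m + 1) * Q', ?_⟩
    convert this using 1
    simp only [Polynomial.smul_eq_C_mul]
    push_cast
    simp
    ring

/-- band structure -/
def Band (Q : Polynomial Op) : Prop :=
  ∀ (p : ℕ) (i j : ℤ), (p : ℤ) < |i - j| → ent (Q.coeff p) i j = 0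

lemma Band.mul {Q R : Polynomial Op} (h : Band Q) (h' : Band R) : Band (Q * R) := by
  intro p i j hp
  rw [Polynomial.coeff_mul, ent_sum]
  refine Finset.sum_eq_zero fun y hy => ?_
  have hy' := Finset.HasAntidiagonal.mem_antidiagonal.mp hy
  refine (hasSum_ent_mul _ _ i j).unique ?_
  convert hasSum_zero using 2 with k
  by_cases hk : (y.1 : ℤ) < |i - k|
  · rw [h _ _ _ hk, zero_mul]
  · rw [h' y.2 k j ?_, mul_zero]
    have := abs_sub_le i k j
    omega

lemma Band.one : Band 1 := by
  intro p i j hp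
  rw [Polynomial.coeff_one]
  split_ifs with h
  · rw [ent_one, if_neg]
    rintro rfl
    simp at hp
    omega
  · exact ent_zero _ _

lemma Band.pow {Q : Polynomial Op} (h : Band Q) (m : ℕ) : Band (Q ^ m) := by
  induction m with
  | zero => simpa using Band.one
  | succ m ih => rw [pow_succ]; exact ih.mul h

/-- the flip anti-automorphism (coefficientwise) -/
def Flip (Q Q' : Polynomial Op) : Prop :=
  ∀ (p : ℕ) (i j : ℤ),
    ent (Q'.coeff p) i j = (-1) ^ (i + j) * ent (Q.coeff p) (j - 1) (i - 1)

lemma neg_one_zpow_aux (i k j : ℤ) :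
    ((-1 : ℂ) ^ (i + k)) * (-1) ^ (k + j) = (-1) ^ (i + j) := by
  rw [← zpow_add₀ (by norm_num), show i + k + (k + j) = (i + j) + 2 * k by ring,
    zpow_add₀ (by norm_num), zpow_mul]
  norm_num

lemma Flip.mul {Q Q' R R' : Polynomial Op} (h : Flip Q Q') (h' : Flip R R') :
    Flip (Q * R) (R' * Q') := by
  intro p i j
  rw [Polynomial.coeff_mul, Polynomial.coeff_mul, ent_sum, ent_sum,
    ← Finset.Nat.sum_antidiagonal_swap, Finset.mul_sum]
  refine Finset.sum_congr rfl fun y _ => ?_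
  refine (hasSum_ent_mul _ _ i j).unique ?_
  have h2 := (hasSum_ent_mul (Q.coeff y.1) (R.coeff y.2) (j - 1) (i - 1)).mul_left
    ((-1 : ℂ) ^ (i + j))
  have h3 := (Equiv.subRight (1 : ℤ)).hasSum_iff.mpr h2
  have e : (fun k => ent (R'.coeff y.swap.1) i k * ent (Q'.coeff y.swap.2) k j) =
      (fun k => (-1 : ℂ) ^ (i + j) * (ent (Q.coeff y.1) (j - 1) k * ent (R.coeff y.2) k (i - 1))) ∘
        (Equiv.subRight (1 : ℤ)) := by
    funext k
    simp only [Prod.fst_swap, Prod.snd_swap, Function.comp, Equiv.subRight_apply]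
    rw [h _ k j, h' _ i k, ← neg_one_zpow_aux i k j]
    ring
  rw [e]
  exact h3

lemma Flip.one : Flip 1 1 := by
  intro p i j
  rw [Polynomial.coeff_one]
  split_ifs with h
  · rw [ent_one, ent_one]
    by_cases hij : i = j
    · subst hij
      simp [← two_mul, zpow_mul]
    · rw [if_neg hij, if_neg (by omega), mul_zero]
  · simp [ent_zero]

lemma Flip.pow {Q Q' : Polynomial Op} (h : Flip Q Q') (m : ℕ) : Flip (Q ^ m) (Q' ^ m) := by
  induction m with
  | zero => simpa using Flip.one
  | succ m ih => rw [pow_succ, pow_succ']; exact ih.mul h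

/-! ### The elementary rotations -/

def sg1 (j : ℤ) : ℂ := if j % 2 = 0 then -1 else 1
def sg2 (j : ℤ) : ℂ := if j % 2 = 0 then 1 else -1
def pm1 (j : ℤ) : ℤ := if j % 2 = 0 then j + 1 else j - 1
def pm2 (j : ℤ) : ℤ := if j % 2 = 0 then j - 1 else j + 1

lemma pm1_inj : Function.Injective pm1 := by
  intro a b h
  unfold pm1 at h
  split_ifs at h <;> omega

lemma pm2_inj : Function.Injective pm2 := by
  intro a b h
  unfold pm2 at h
  split_ifs at h <;> omega

lemma sg1_norm (j : ℤ) : ‖sg1 j‖ = 1 := by unfold sg1; split_ifs <;> simp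
lemma sg2_norm (j : ℤ) : ‖sg2 j‖ = 1 := by unfold sg2; split_ifs <;> simp

/-- `A δ_j = s_j δ_{σ j}` -/
def IsWP (s : ℤ → ℂ) (σ : ℤ → ℤ) (A : Op) : Prop := ∀ j, A (δ j) = s j • δ (σ j)

lemma IsWP.ent {s : ℤ → ℂ} {σ : ℤ → ℤ} {A : Op} (h : IsWP s σ A) (i j : ℤ) :
    ent A i j = if i = σ j then s j else 0 := by
  unfold _root_.ent
  rw [h j, coord_smul, coord_delta]
  simp

lemma exists_op (s : ℤ → ℂ) (hs : ∀ j, ‖s j‖ = 1) (σ : ℤ → ℤ) (hσ : Function.Injective σ) :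
    ∃ A : Op, IsWP s σ A ∧ ∀ ψ φ, inner ℂ (A ψ) (A φ) = inner ℂ ψ φ := by
  obtain ⟨L, hL⟩ := exists_wp s hs σ hσ
  exact ⟨L.toContinuousLinearMap, hL, fun ψ φ => L.inner_map_map ψ φ⟩

lemma norm_eq_of_inner {A : Op} (h : ∀ ψ φ, inner ℂ (A ψ) (A φ) = inner ℂ ψ φ) (ψ : Hqw) :
    ‖A ψ‖ = ‖ψ‖ := by
  have h1 := h ψ ψ
  rw [inner_self_eq_norm_sq_to_K, inner_self_eq_norm_sq_to_K] at h1
  have h2 : ‖A ψ‖ ^ 2 = ‖ψ‖ ^ 2 := by exact_mod_cast h1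
  exact (sq_eq_sq₀ (norm_nonneg _) (norm_nonneg _)).mp h2

lemma norm_le_one_of_inner {A : Op} (h : ∀ ψ φ, inner ℂ (A ψ) (A φ) = inner ℂ ψ φ) :
    ‖A‖ ≤ 1 :=
  A.opNorm_le_bound zero_le_one fun ψ => by rw [norm_eq_of_inner h, one_mul]

lemma IsWP.norm_le {s : ℤ → ℂ} {σ : ℤ → ℤ} {A : Op} (h : IsWP s σ A) (hs : ∀ j, ‖s j‖ = 1)
    (hσ : Function.Injective σ) : ‖A‖ ≤ 1 := by
  obtain ⟨A', h1, h2⟩ := exists_op s hs σ hσ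
  have : A = A' := op_ext fun j => (h j).trans (h1 j).symm
  rw [this]
  exact norm_le_one_of_inner h2

/-- a rotation `r + t J` with `J` isometric, `J² = -1`, is a contraction -/
lemma rot_norm_le {J : Op} (hJ : ∀ ψ φ, inner ℂ (J ψ) (J φ) = inner ℂ ψ φ)
    (hJ2 : ∀ ψ, J (J ψ) = -ψ) (r t : ℝ) (hrt : r ^ 2 + t ^ 2 = 1) :
    ‖((r : ℂ) • (1 : Op) + (t : ℂ) • J)‖ ≤ 1 := by
  refine ContinuousLinearMap.opNorm_le_bound _ zero_le_one fun ψ => ?_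
  have h0 : RCLike.re (inner ℂ ψ (J ψ)) = 0 := by
    have h1 := hJ ψ (J ψ)
    rw [hJ2, inner_neg_right] at h1
    have h2 : RCLike.re (inner ℂ (J ψ) ψ) = RCLike.re (inner ℂ ψ (J ψ)) := inner_re_symm _ _
    have h3 := congrArg (RCLike.re : ℂ → ℝ) h1
    rw [map_neg, h2] at h3
    linarith
  have h4 : ‖(r : ℂ) • ψ + (t : ℂ) • J ψ‖ ^ 2 = ‖ψ‖ ^ 2 := by
    rw [norm_add_sq (𝕜 := ℂ), inner_smul_left, inner_smul_right, norm_smul, norm_smul,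
      norm_eq_of_inner hJ]
    have : RCLike.re ((starRingEnd ℂ) (r : ℂ) * ((t : ℂ) * inner ℂ ψ (J ψ))) = 0 := by
      have h5 : (inner ℂ ψ (J ψ)).re = 0 := h0
      simp [h5]
    rw [this]
    simp only [Complex.norm_real, Real.norm_eq_abs, mul_pow, sq_abs]
    linear_combination ‖ψ‖ ^ 2 * hrt
  have h5 : ‖(r : ℂ) • ψ + (t : ℂ) • J ψ‖ = ‖ψ‖ :=
    (sq_eq_sq₀ (norm_nonneg _) (norm_nonneg _)).mp h4
  rw [one_mul]
  exact h5.le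

/-! ### Linear operator polynomials -/

def Vp (J : Op) : Polynomial Op := Polynomial.C 1 + Polynomial.C J * Polynomial.X

lemma Vp_coeff (J : Op) (p : ℕ) :
    (Vp J).coeff p = if p = 0 then 1 else if p = 1 then J else 0 := by
  unfold Vp
  rcases p with _ | _ | p <;>
    simp only [Polynomial.coeff_add, Polynomial.coeff_C, Polynomial.coeff_C_mul,
      Polynomial.coeff_X] <;> simp

lemma Vp_band {J : Op} (h : ∀ i j, (1 : ℤ) < |i - j| → ent J i j = 0) : Band (Vp J) := by
  intro p i j hp
  rw [Vp_coeff]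
  split_ifs with h1 h2
  · have := Band.one 0 i j (by simpa [h1] using hp)
    simpa using this
  · exact h i j (by simpa [h2] using hp)
  · exact ent_zero _ _

lemma C_band {D : Op} (h : ∀ i j, i ≠ j → ent D i j = 0) : Band (Polynomial.C D) := by
  intro p i j hp
  rw [Polynomial.coeff_C]
  split_ifs with h1
  · apply h
    rintro rfl
    simp at hp
    omega
  · exact ent_zero _ _

lemma Vp_flip {J J' : Op}
    (h : ∀ i j, ent J' i j = (-1) ^ (i + j) * ent J (j - 1) (i - 1)) : Flip (Vp J) (Vp J') := by
  intro p i j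
  rw [Vp_coeff, Vp_coeff]
  split_ifs with h1 h2
  · simpa using Flip.one 0 i j
  · exact h i j
  · simp [ent_zero]

lemma C_flip {J J' : Op}
    (h : ∀ i j, ent J' i j = (-1) ^ (i + j) * ent J (j - 1) (i - 1)) :
    Flip (Polynomial.C J) (Polynomial.C J') := by
  intro p i j
  rw [Polynomial.coeff_C, Polynomial.coeff_C]
  split_ifs with h1
  · exact h i j
  · simp [ent_zero]

lemma Vp_maj {x : ℤ → ℝ} {J K : Op} (h : IsXComm x J K) (hJ : ‖J‖ ≤ 1) {κ : ℝ} (hK : ‖K‖ ≤ κ) :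
    Maj x (Vp J) (Polynomial.C K * Polynomial.X) (1 + Polynomial.X)
      (Polynomial.C κ * Polynomial.X) := by
  intro p
  rw [Vp_coeff]
  rcases p with _ | _ | p
  · simpa using ⟨IsXComm.one x, ContinuousLinearMap.norm_id_le⟩
  · simpa [Polynomial.coeff_one] using ⟨h, hJ, hK⟩
  · simpa [Polynomial.coeff_one, Polynomial.coeff_X] using IsXComm.zero x

lemma C_maj {x : ℤ → ℝ} {D : Op} (h : IsXComm x D 0) (hD : ‖D‖ ≤ 1) :
    Maj x (Polynomial.C D) 0 1 0 := by
  intro p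
  rcases p with _ | p
  · simpa using ⟨h, hD⟩
  · simpa [Polynomial.coeff_one, Polynomial.coeff_C] using IsXComm.zero x

/-! ### Low order coefficients are scalar -/

lemma coeff_scalar {n : ℕ} {α : ℂ} (hα : IsPrimitiveRoot α n) (hn : 1 < n) {D : Op}
    (hD : IsWP (fun j => α ^ j) id D) {M M' : Polynomial Op}
    (hM0 : M.coeff 0 = D) (hband : Band M) (hflip : Flip M M')
    (hMM' : Polynomial.C D * M' ^ n = M ^ n * Polynomial.C D) (p : ℕ) (hp : p < n) :
    ∃ c : ℂ, (M ^ n).coeff p = c • (1 : Op) := by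
  have hα0 : α ≠ 0 := hα.ne_zero (by omega)
  have hDl : ∀ (A : Op) (i j : ℤ), ent (D * A) i j = α ^ i * ent A i j := by
    intro A i j
    refine (hasSum_ent_mul D A i j).unique ?_
    convert hasSum_single i ?_ using 1
    · rw [hD.ent]; simp
    · intro k hk
      rw [hD.ent, if_neg (by simpa using hk.symm), zero_mul]
  have hDr : ∀ (A : Op) (i j : ℤ), ent (A * D) i j = ent A i j * α ^ j := by
    intro A i j
    refine (hasSum_ent_mul A D i j).unique ?_
    convert hasSum_single j ?_ using 1
    · rw [hD.ent]; simp
    · intro k hk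
      rw [hD.ent, if_neg (by simpa using hk), mul_zero]
  induction p using Nat.strong_induction_on with
  | _ p ih =>
  have hcomm : D * (M ^ n).coeff p = (M ^ n).coeff p * D := by
    have h1 : (M * M ^ n).coeff p = (M ^ n * M).coeff p := by rw [← pow_succ, ← pow_succ']
    rw [Polynomial.coeff_mul, Polynomial.coeff_mul,
      ← Finset.Nat.sum_antidiagonal_swap (n := p)
        (f := fun y : ℕ × ℕ => (M ^ n).coeff y.1 * M.coeff y.2)] at h1
    have hmem : ((0, p) : ℕ × ℕ) ∈ Finset.HasAntidiagonal.antidiagonal p := by simp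
    rw [← Finset.add_sum_erase _ _ hmem, ← Finset.add_sum_erase _ _ hmem] at h1
    have h2 : ∀ y ∈ (Finset.HasAntidiagonal.antidiagonal p).erase ((0, p) : ℕ × ℕ),
        M.coeff y.1 * (M ^ n).coeff y.2 = (M ^ n).coeff y.swap.1 * M.coeff y.swap.2 := by
      rintro ⟨a, b⟩ hy
      simp only [Finset.mem_erase, ne_eq, Prod.mk.injEq, not_and,
        Finset.HasAntidiagonal.mem_antidiagonal] at hy
      have hb : b < p := by
        rcases Nat.eq_zero_or_pos a with h | h
        · exact absurd (by omega) (hy.1 h)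
        · omega
      obtain ⟨c, hc⟩ := ih b hb (hb.trans hp)
      simp [hc]
    rw [Finset.sum_congr rfl h2] at h1
    have h3 := add_right_cancel h1
    simpa [hM0] using h3
  have hoff : ∀ i j, i ≠ j → ent ((M ^ n).coeff p) i j = 0 := by
    intro i j hij
    by_cases hlt : (p : ℤ) < |i - j|
    · exact hband.pow n p i j hlt
    · have h1 := congrArg (fun A => ent A i j) hcomm
      simp only [hDl, hDr] at h1
      by_contra hne
      have h2 : α ^ i = α ^ j := by
        rw [mul_comm] at h1
        exact mul_left_cancel₀ hne h1
      have h3 : α ^ (i - j) = 1 := by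
        rw [zpow_sub₀ hα0, h2, div_self (zpow_ne_zero _ hα0)]
      have h4 := (hα.zpow_eq_one_iff_dvd _).mp h3
      have h5 := Int.le_of_dvd (abs_pos.mpr (sub_ne_zero.mpr hij)) ((dvd_abs _ _).mpr h4)
      omega
  have hdiag : ∀ i, ent ((M ^ n).coeff p) i i = ent ((M ^ n).coeff p) (i - 1) (i - 1) := by
    intro i
    have h1 := congrArg (fun Q : Polynomial Op => ent (Q.coeff p) i i) hMM'
    simp only [Polynomial.coeff_C_mul, Polynomial.coeff_mul_C, hDl, hDr] at h1
    have h2 := hflip.pow n p i i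
    rw [← two_mul, zpow_mul] at h2
    norm_num at h2
    rw [← h2]
    rw [mul_comm] at h1
    exact (mul_right_cancel₀ (zpow_ne_zero i hα0) h1).symm
  have hconst : ∀ i, ent ((M ^ n).coeff p) i i = ent ((M ^ n).coeff p) 0 0 := by
    intro i
    induction i using Int.induction_on with
    | zero => rfl
    | succ k hk => rw [hdiag]; simpa using hk
    | pred k hk => rw [← hdiag]; exact hk
  refine ⟨ent ((M ^ n).coeff p) 0 0, ent_ext fun i j => ?_⟩
  rw [ent_smul, ent_one]
  split_ifs with h
  · subst h; rw [hconst, mul_one]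
  · rw [hoff i j h, mul_zero]

/-! ### Assembling -/

lemma sum_coeff_le_eval {b : Polynomial ℝ} (hb : ∀ p, 0 ≤ b.coeff p) (m : ℕ) :
    ∑ p ∈ Finset.range m, b.coeff p ≤ b.eval 1 := by
  have h : b.natDegree < max m (b.natDegree + 1) := by
    have := le_max_right m (b.natDegree + 1)
    omega
  rw [Polynomial.eval_eq_sum_range' h]
  simp only [one_pow, mul_one]
  exact Finset.sum_le_sum_of_subset_of_nonneg
    (Finset.range_subset_range.mpr (le_max_left _ _)) fun p _ _ => hb p

lemma pos_eq {x : ℤ → ℝ} (hx : IsPos x) (j : ℤ) : x j = ((|j / 2| : ℤ) : ℝ) := by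
  have h := hx (j / 2)
  push_cast
  rcases Int.emod_two_eq_zero_or_one j with h2 | h2
  · rw [show j = 2 * (j / 2) by omega, h.1]
    congr 2
    omega
  · rw [show j = 2 * (j / 2) + 1 by omega, h.2]
    congr 2
    omega

lemma comm_J1 {x : ℤ → ℝ} (hx : IsPos x) {J : Op} (hJ : IsWP sg1 pm1 J) : IsXComm x J 0 := by
  intro i j
  change (0 : ℂ) = _ * ent J i j
  rw [hJ.ent]
  split_ifs with h
  · have : x i = x j := by
      rw [pos_eq hx, pos_eq hx, h]
      have : pm1 j / 2 = j / 2 := by unfold pm1; split_ifs <;> omega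
      rw [this]
    rw [this]
    simp
  · simp

lemma comm_D {x : ℤ → ℝ} {s : ℤ → ℂ} {J : Op} (hJ : IsWP s id J) : IsXComm x J 0 := by
  intro i j
  change (0 : ℂ) = _ * ent J i j
  rw [hJ.ent]
  split_ifs with h
  · simp [h]
  · simp

lemma comm_J2 {x : ℤ → ℝ} (hx : IsPos x) {J : Op} (hJ : IsWP sg2 pm2 J) :
    ∃ K, IsXComm x J K ∧ ‖K‖ ≤ 1 := by
  have hs : ∀ j, ‖((x (pm2 j) - x j : ℝ) : ℂ) * sg2 j‖ = 1 := by
    intro j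
    rw [norm_mul, sg2_norm, mul_one, Complex.norm_real, pos_eq hx, pos_eq hx, ← Int.cast_sub,
      Real.norm_eq_abs, ← Int.cast_abs]
    have : |(|pm2 j / 2| - |j / 2|)| = 1 := by
      have key : ∀ a b : ℤ, (a = b - 1 ∨ a = b + 1) → |(|a| - |b|)| = 1 := by
        intro a b hab
        rcases abs_cases a with h | h <;> rcases abs_cases b with h' | h' <;>
          rcases abs_cases (|a| - |b|) with h'' | h'' <;> omega
      apply key
      unfold pm2
      split_ifs <;> omega
    rw [this]
    simp
  obtain ⟨K, hK, _⟩ := exists_op _ hs pm2 pm2_inj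
  refine ⟨K, ?_, hK.norm_le hs pm2_inj⟩
  intro i j
  change ent K i j = _ * ent J i j
  rw [hK.ent, hJ.ent]
  split_ifs with h
  · rw [h]
  · simp

lemma J1_sq {J : Op} (hJ : IsWP sg1 pm1 J) (ψ : Hqw) : J (J ψ) = -ψ := by
  have : J * J = -1 := by
    refine op_ext fun j => ?_
    change J (J (δ j)) = - δ j
    rw [hJ, map_smul, hJ, smul_smul]
    have h1 : pm1 (pm1 j) = j := by unfold pm1; split_ifs <;> omega
    have h2 : sg1 j * sg1 (pm1 j) = -1 := by
      unfold sg1 pm1; split_ifs <;> first | omega | norm_num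
    rw [h1, h2, neg_one_smul]
  exact congrArg (fun A : Op => A ψ) this

lemma J2_sq {J : Op} (hJ : IsWP sg2 pm2 J) (ψ : Hqw) : J (J ψ) = -ψ := by
  have : J * J = -1 := by
    refine op_ext fun j => ?_
    change J (J (δ j)) = - δ j
    rw [hJ, map_smul, hJ, smul_smul]
    have h1 : pm2 (pm2 j) = j := by unfold pm2; split_ifs <;> omega
    have h2 : sg2 j * sg2 (pm2 j) = -1 := by
      unfold sg2 pm2; split_ifs <;> first | omega | norm_num
    rw [h1, h2, neg_one_smul]
  exact congrArg (fun A : Op => A ψ) this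

lemma flip_12 {J1 J2 : Op} (h1 : IsWP sg1 pm1 J1) (h2 : IsWP sg2 pm2 J2) (i j : ℤ) :
    ent J2 i j = (-1) ^ (i + j) * ent J1 (j - 1) (i - 1) := by
  rw [h1.ent, h2.ent]
  by_cases h : i = pm2 j
  · have h' : j - 1 = pm1 (i - 1) := by
      unfold pm2 at h; unfold pm1
      split_ifs at h ⊢ <;> omega
    rw [if_pos h, if_pos h']
    have ho : Odd (i + j) := by
      rw [Int.odd_iff]
      unfold pm2 at h
      split_ifs at h <;> omega
    rw [ho.neg_one_zpow]
    unfold sg1 sg2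
    unfold pm2 at h
    split_ifs at h ⊢ <;> first | omega | norm_num
  · have h' : j - 1 ≠ pm1 (i - 1) := by
      intro h'
      apply h
      unfold pm1 at h'; unfold pm2
      split_ifs at h' ⊢ <;> omega
    rw [if_neg h, if_neg h', mul_zero]

lemma flip_21 {J1 J2 : Op} (h1 : IsWP sg1 pm1 J1) (h2 : IsWP sg2 pm2 J2) (i j : ℤ) :
    ent J1 i j = (-1) ^ (i + j) * ent J2 (j - 1) (i - 1) := by
  rw [h1.ent, h2.ent]
  by_cases h : i = pm1 j
  · have h' : j - 1 = pm2 (i - 1) := by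
      unfold pm1 at h; unfold pm2
      split_ifs at h ⊢ <;> omega
    rw [if_pos h, if_pos h']
    have ho : Odd (i + j) := by
      rw [Int.odd_iff]
      unfold pm1 at h
      split_ifs at h <;> omega
    rw [ho.neg_one_zpow]
    unfold sg1 sg2
    unfold pm1 at h
    split_ifs at h ⊢ <;> first | omega | norm_num
  · have h' : j - 1 ≠ pm2 (i - 1) := by
      intro h'
      apply h
      unfold pm2 at h'; unfold pm1
      split_ifs at h' ⊢ <;> omega
    rw [if_neg h, if_neg h', mul_zero]

lemma B_eq {B J1 J2 : Op} (hB : IsB B) (h1 : IsWP sg1 pm1 J1) (h2 : IsWP sg2 pm2 J2) :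
    B = J1 + J2 := by
  refine op_ext fun j => ?_
  change B (δ j) = J1 (δ j) + J2 (δ j)
  rw [hB, h1, h2]
  unfold sg1 sg2 pm1 pm2
  split_ifs <;> module

lemma C_eq {C J1 J2 : Op} (hC : IsC C) (h1 : IsWP sg1 pm1 J1) (h2 : IsWP sg2 pm2 J2) :
    C = J2 * J1 := by
  refine op_ext fun j => ?_
  change C (δ j) = J2 (J1 (δ j))
  rw [h1, map_smul, h2, smul_smul]
  rcases Int.emod_two_eq_zero_or_one j with h | h
  · have h3 := (hC (j / 2)).1
    rw [show 2 * (j / 2) = j by omega] at h3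
    have e1 : pm1 j = j + 1 := by unfold pm1; rw [if_pos h]
    have e2 : pm2 (j + 1) = j + 2 := by unfold pm2; rw [if_neg (by omega)]; ring
    have e3 : sg1 j * sg2 (j + 1) = 1 := by
      unfold sg1 sg2; rw [if_pos h, if_neg (by omega)]; norm_num
    rw [h3, e1, e2, e3, one_smul]
  · have h3 := (hC (j / 2)).2
    rw [show 2 * (j / 2) + 1 = j by omega, show 2 * (j / 2) - 1 = j - 2 by omega] at h3
    have e1 : pm1 j = j - 1 := by unfold pm1; rw [if_neg (by omega)]
    have e2 : pm2 (j - 1) = j - 2 := by unfold pm2; rw [if_pos (by omega)]; ring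
    have e3 : sg1 j * sg2 (j - 1) = 1 := by
      unfold sg1 sg2; rw [if_neg (by omega), if_pos (by omega)]; norm_num
    rw [h3, e1, e2, e3, one_smul]

lemma U_eq (r t : ℂ) (J1 J2 : Op) :
    (r • (1 : Op) + t • J2) * (r • (1 : Op) + t • J1) =
      (r ^ 2) • (1 : Op) + (r * t) • (J1 + J2) + (t ^ 2) • (J2 * J1) := by
  simp only [mul_add, add_mul, smul_mul_assoc, mul_smul_comm, one_mul, mul_one]
  module

lemma prim_of_admissible {n : ℕ} (hn : 1 < n) {α : ℂ} (hα : IsAdmissible n α) :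
    IsPrimitiveRoot α n := by
  obtain ⟨_, k, _, hk, rfl⟩ := hα
  have h := Complex.isPrimitiveRoot_exp_of_coprime k n (by omega) hk
  convert h using 2
  push_cast
  ring

/-- the key estimate on one period -/
lemma period_bound {n : ℕ} (hn : 1 < n) {α : ℂ} (hα : IsPrimitiveRoot α n) {D J1 J2 : Op}
    (hD : IsWP (fun j => α ^ j) id D) (h1 : IsWP sg1 pm1 J1) (h2 : IsWP sg2 pm2 J2)
    {x : ℤ → ℝ} (hx : IsPos x) {r t : ℝ} (ht : 0 < t) (htr : t ≤ r) (hr1 : r ≤ 1) :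
    ∃ K, IsXComm x ((D * (((r : ℂ) • (1 : Op) + (t : ℂ) • J2) *
      ((r : ℂ) • (1 : Op) + (t : ℂ) • J1))) ^ n) K ∧ ‖K‖ ≤ n * (4 * t) ^ n / 2 := by
  have hr : 0 < r := ht.trans_le htr
  have hα0 : α ≠ 0 := hα.ne_zero (by omega)
  have hα1 : ∀ j : ℤ, ‖α ^ j‖ = 1 := by
    intro j
    rw [norm_zpow, hα.norm'_eq_one (by omega), one_zpow]
  have hDn : ‖D‖ ≤ 1 := hD.norm_le hα1 Function.injective_id
  obtain ⟨K2, hK2, hK2n⟩ := comm_J2 hx h2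
  have hJ1n := h1.norm_le sg1_norm pm1_inj
  have hJ2n := h2.norm_le sg2_norm pm2_inj
  set Y : Polynomial Op := Vp J2 * Vp J1 with hY
  set M : Polynomial Op := Polynomial.C D * Y with hM
  set z : Polynomial Op := Polynomial.C (α⁻¹ • (1 : Op)) with hz
  have hzc : ∀ Q : Polynomial Op, Commute Q z := by
    intro Q
    ext1 p
    rw [Polynomial.coeff_mul_C, Polynomial.coeff_C_mul]
    simp
  have hband : Band M := by
    refine (C_band fun i j hij => ?_).mul ((Vp_band fun i j hij => ?_).mul
      (Vp_band fun i j hij => ?_))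
    · rw [hD.ent, if_neg (by simpa using hij)]
    · rw [h2.ent, if_neg]
      rintro rfl
      unfold pm2 at hij
      split_ifs at hij <;> simp at hij
    · rw [h1.ent, if_neg]
      rintro rfl
      unfold pm1 at hij
      split_ifs at hij <;> simp at hij
  have hflip : Flip M (Y * Polynomial.C (α⁻¹ • D)) := by
    refine Flip.mul (C_flip fun i j => ?_)
      ((Vp_flip (flip_21 h1 h2)).mul (Vp_flip (flip_12 h1 h2)))
    rw [ent_smul, hD.ent, hD.ent]
    by_cases h : i = j
    · subst h
      rw [← two_mul, zpow_mul]
      simp [zpow_sub₀ hα0]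
      field_simp
    · rw [if_neg (by simpa using h), if_neg (by simp; omega)]
      simp
  have hzn : z ^ n = 1 := by
    rw [hz, ← Polynomial.C_pow, smul_pow, one_pow, inv_pow, hα.pow_eq_one]
    simp
  have hMM' : Polynomial.C D * (Y * Polynomial.C (α⁻¹ • D)) ^ n = M ^ n * Polynomial.C D := by
    have e : Y * Polynomial.C (α⁻¹ • D) = (Y * Polynomial.C D) * z := by
      rw [hz, mul_assoc Y, ← Polynomial.C_mul]
      simp
    rw [e, (hzc _).mul_pow, hzn, mul_one, hM, mul_pow_mul]
  have hM0 : M.coeff 0 = D := by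
    rw [hM, hY, Polynomial.coeff_C_mul, Polynomial.mul_coeff_zero, Vp_coeff, Vp_coeff]
    simp
  have hsc := coeff_scalar hα hn hD hM0 hband hflip hMM'
  have hmaj := (C_maj (comm_D hD) hDn).mul ((Vp_maj hK2 hJ2n hK2n).mul
    (Vp_maj (comm_J1 hx h1) hJ1n (κ := 0) (by simp)))
  obtain ⟨R, hR⟩ := hmaj.pow (n - 1)
  rw [show n - 1 + 1 = n by omega, ← hY, ← hM] at hR
  set b : Polynomial ℝ := _ with hb
  change Maj x (M ^ n) R _ b at hR
  have hbe : b.eval 1 = n * 4 ^ n / 2 := by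
    have e : (n : ℝ) = ((n - 1 : ℕ) : ℝ) + 1 := by
      have : n = n - 1 + 1 := by omega
      exact_mod_cast this
    have e2 : (4 : ℝ) ^ n = 4 ^ (n - 1) * 4 := by
      rw [← pow_succ, show n - 1 + 1 = n by omega]
    rw [hb, e2, e]
    simp
    norm_num
    ring
  have hR0 : ∀ p < n, R.coeff p = 0 := by
    intro p hp
    obtain ⟨c, hc⟩ := hsc p hp
    have h3 := (hR p).1
    rw [hc] at h3
    have h4 := (IsXComm.one x).smul c
    rw [smul_zero] at h4
    exact h3.uniq h4
  have hb0 : ∀ p, 0 ≤ b.coeff p := fun p => (norm_nonneg _).trans (hR p).2.2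
  -- evaluation
  set τ : ℂ := (t : ℂ) / r with hτ
  have hrc : (r : ℂ) ≠ 0 := by exact_mod_cast hr.ne'
  have hcen : ∀ A : Op, Commute (RingHom.id Op A) (algebraMap ℂ Op τ) :=
    fun A => (Algebra.commutes τ A).symm
  set φ := Polynomial.eval₂RingHom' (RingHom.id Op) (algebraMap ℂ Op τ) hcen with hφ
  have hφV : ∀ J : Op, (r : ℂ) • φ (Vp J) = (r : ℂ) • (1 : Op) + (t : ℂ) • J := by
    intro J
    have e : φ (Vp J) = 1 + τ • J := by
      rw [Vp, map_add, map_mul, hφ]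
      simp [Algebra.algebraMap_eq_smul_one]
    rw [e, smul_add, smul_smul, hτ, mul_div_cancel₀ _ hrc]
  have hφC : φ (Polynomial.C D) = D := by rw [hφ]; simp
  have hA : (D * (((r : ℂ) • (1 : Op) + (t : ℂ) • J2) *
      ((r : ℂ) • (1 : Op) + (t : ℂ) • J1))) ^ n = ((r : ℂ) ^ 2) ^ n • φ (M ^ n) := by
    rw [← hφV, ← hφV, map_pow, hM, hY, map_mul, map_mul, hφC, ← smul_pow]
    congr 1
    simp only [smul_mul_assoc, mul_smul_comm, smul_smul]
    congr 1
    ring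
  have hsum : φ (M ^ n) =
      ∑ p ∈ Finset.range ((M ^ n).natDegree + 1), τ ^ p • (M ^ n).coeff p := by
    rw [hφ]
    change Polynomial.eval₂ _ _ _ = _
    rw [Polynomial.eval₂_eq_sum_range]
    refine Finset.sum_congr rfl fun p _ => ?_
    rw [← map_pow, Algebra.algebraMap_eq_smul_one]
    simp
  rw [hA, hsum]
  refine ⟨((r : ℂ) ^ 2) ^ n • ∑ p ∈ Finset.range ((M ^ n).natDegree + 1), τ ^ p • R.coeff p,
    (IsXComm.sum _ _ _ fun p _ => (hR p).1.smul _).smul _, ?_⟩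
  have hτn : ‖τ‖ = t / r := by
    rw [hτ, norm_div, Complex.norm_real, Complex.norm_real, Real.norm_of_nonneg ht.le,
      Real.norm_of_nonneg hr.le]
  have hτ1 : t / r ≤ 1 := (div_le_one hr).mpr htr
  have hterm : ∀ p ∈ Finset.range ((M ^ n).natDegree + 1),
      ‖τ ^ p • R.coeff p‖ ≤ (t / r) ^ n * b.coeff p := by
    intro p _
    by_cases hp : p < n
    · rw [hR0 p hp, smul_zero, norm_zero]
      exact mul_nonneg (by positivity) (hb0 p)
    · rw [norm_smul, norm_pow, hτn]
      exact mul_le_mul (pow_le_pow_of_le_one (by positivity) hτ1 (by omega)) (hR p).2.2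
        (norm_nonneg _) (by positivity)
  have hS := (norm_sum_le _ _).trans (Finset.sum_le_sum hterm)
  rw [← Finset.mul_sum] at hS
  have hS2 := hS.trans (mul_le_mul_of_nonneg_left (sum_coeff_le_eval hb0 _)
    (by positivity : 0 ≤ (t / r) ^ n))
  rw [norm_smul, norm_pow, norm_pow, Complex.norm_real, Real.norm_of_nonneg hr.le]
  calc _ ≤ (r ^ 2) ^ n * ((t / r) ^ n * b.eval 1) := by gcongr
    _ = r ^ n * (t ^ n * (n * 4 ^ n / 2)) := by
      rw [hbe, div_pow, ← pow_mul, mul_comm 2 n, pow_mul]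
      field_simp
    _ ≤ 1 * (t ^ n * (n * 4 ^ n / 2)) := by
      gcongr
      exact pow_le_one₀ hr.le hr1
    _ = n * (4 * t) ^ n / 2 := by rw [mul_pow]; ring

/-- for every integer `n > 1`, admissible `α`, `t ∈ (0,1)`, and every
integer `N > max{n/(4t)^{n-1}, n}`, `(1/N)‖[X, U_{t,n}^N]‖ ≤ (4t)^n`. -/
theorem stmt6 (n : ℕ) (hn : 1 < n) (α : ℂ) (hα : IsAdmissible n α)
    (t : ℝ) (ht : t ∈ Set.Ioo (0 : ℝ) 1)
    (B C D : Op) (hB : IsB B) (hC : IsC C) (hD : IsDn α D)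
    (x : ℤ → ℝ) (hx : IsPos x)
    (N : ℕ) (hN : max ((n : ℝ) / (4 * t) ^ (n - 1)) (n : ℝ) < (N : ℝ))
    (K : Op) (hK : IsXComm x ((D * Ut t B C) ^ N) K) :
    (1 / (N : ℝ)) * ‖K‖ ≤ (4 * t) ^ n := by
  have hprim := prim_of_admissible hn hα
  obtain ⟨ht0, ht1⟩ := ht
  obtain ⟨J1, h1, h1i⟩ := exists_op sg1 sg1_norm pm1 pm1_inj
  obtain ⟨J2, h2, h2i⟩ := exists_op sg2 sg2_norm pm2 pm2_inj
  have hDw : IsWP (fun j => α ^ j) id D := hD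
  have hDn : ‖D‖ ≤ 1 := hDw.norm_le (fun j => by
    rw [norm_zpow, hprim.norm'_eq_one (by omega), one_zpow]) Function.injective_id
  set r : ℝ := Real.sqrt (1 - t ^ 2) with hr
  have hrt : r ^ 2 + t ^ 2 = 1 := by
    rw [hr, Real.sq_sqrt (by nlinarith)]
    ring
  have hr0 : 0 ≤ r := Real.sqrt_nonneg _
  have hU : Ut t B C = ((r : ℂ) • (1 : Op) + (t : ℂ) • J2) *
      ((r : ℂ) • (1 : Op) + (t : ℂ) • J1) := by
    rw [U_eq, Ut, B_eq hB h1 h2, C_eq hC h1 h2, ← hr]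
    push_cast
    rfl
  have hV1 := rot_norm_le h1i (J1_sq h1) r t hrt
  have hV2 := rot_norm_le h2i (J2_sq h2) r t hrt
  rw [hU] at hK
  obtain ⟨K2, hK2, hK2n⟩ := comm_J2 hx h2
  set V1 : Op := (r : ℂ) • (1 : Op) + (t : ℂ) • J1 with hV1d
  set V2 : Op := (r : ℂ) • (1 : Op) + (t : ℂ) • J2 with hV2d
  set A : Op := D * (V2 * V1) with hAd
  have hAn : ‖A‖ ≤ 1 := by
    refine (norm_mul_le _ _).trans (mul_le_one₀ hDn (norm_nonneg _) ?_)
    exact (norm_mul_le _ _).trans (mul_le_one₀ hV2 (norm_nonneg _) hV1)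
  have hcA : ∃ K1, IsXComm x A K1 ∧ ‖K1‖ ≤ t := by
    have c1 : IsXComm x V1 0 := by
      have := ((IsXComm.one x).smul (r : ℂ)).add ((comm_J1 hx h1).smul (t : ℂ))
      rwa [smul_zero, smul_zero, add_zero] at this
    have c2 : IsXComm x V2 ((t : ℂ) • K2) := by
      have := ((IsXComm.one x).smul (r : ℂ)).add (hK2.smul (t : ℂ))
      rwa [smul_zero, zero_add] at this
    have c3 := (comm_D hDw).mul (c2.mul c1)
    refine ⟨_, c3, ?_⟩
    rw [mul_zero, add_zero, zero_mul, zero_add]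
    refine (norm_mul_le _ _).trans ?_
    have e1 : ‖(t : ℂ) • K2‖ ≤ t := by
      rw [norm_smul, Complex.norm_real, Real.norm_of_nonneg ht0.le]
      nlinarith
    have e2 : ‖((t : ℂ) • K2) * V1‖ ≤ t := by
      refine (norm_mul_le _ _).trans ?_
      nlinarith [norm_nonneg V1, norm_nonneg ((t : ℂ) • K2)]
    nlinarith [norm_nonneg D, norm_nonneg (((t : ℂ) • K2) * V1)]
  obtain ⟨K1, hK1, hK1n⟩ := hcA
  have hN0 : (n : ℝ) < N := (le_max_right _ _).trans_lt hN
  have hn0 : (0 : ℝ) < n := by exact_mod_cast (by omega : 0 < n)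
  have hNpos : (0 : ℝ) < N := hn0.trans hN0
  suffices hfin : ‖K‖ ≤ (4 * t) ^ n * N by
    rw [one_div, inv_mul_eq_div, div_le_iff₀ hNpos]
    exact hfin
  rcases le_or_gt 1 (4 * t) with h4 | h4
  · obtain ⟨K', hK', hK'n⟩ := hK1.pow hAn N
    rw [hK.uniq hK']
    have e : 4 * t ≤ (4 * t) ^ n := le_self_pow₀ h4 (by omega)
    have e2 : (N : ℝ) * ‖K1‖ ≤ N * t := by gcongr
    nlinarith
  · have htr : t ≤ r := by
      nlinarith
    have hr1 : r ≤ 1 := by nlinarith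
    obtain ⟨Kn, hKn, hKnn⟩ := period_bound hn hprim hDw h1 h2 hx ht0 htr hr1
    rw [← hV1d, ← hV2d, ← hAd] at hKn
    obtain ⟨Km, hKm, hKmn⟩ := hKn.pow (norm_op_pow_le hAn n) (N / n)
    obtain ⟨Ks, hKs, hKsn⟩ := hK1.pow hAn (N % n)
    have hc := hKm.mul hKs
    rw [← pow_mul, ← pow_add, Nat.div_add_mod] at hc
    rw [hK.uniq hc]
    have hP : 0 < (4 * t) ^ (n - 1) := by positivity
    have hNP : (n : ℝ) < N * (4 * t) ^ (n - 1) := by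
      rw [← div_lt_iff₀ hP]
      exact (le_max_left _ _).trans_lt hN
    have epow : (4 * t) ^ n = (4 * t) ^ (n - 1) * (4 * t) := by
      rw [← pow_succ, show n - 1 + 1 = n by omega]
    have hs : ((N % n : ℕ) : ℝ) ≤ n := by
      exact_mod_cast (Nat.mod_lt N (by omega)).le
    have hm : ((N / n : ℕ) : ℝ) * n ≤ N := by
      exact_mod_cast Nat.div_mul_le_self N n
    have b1 : ‖Km‖ ≤ (4 * t) ^ n * N / 2 := by
      calc ‖Km‖ ≤ (N / n : ℕ) * ‖Kn‖ := hKmn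
        _ ≤ (N / n : ℕ) * (n * (4 * t) ^ n / 2) := by gcongr
        _ = (((N / n : ℕ) : ℝ) * n) * ((4 * t) ^ n / 2) := by ring
        _ ≤ N * ((4 * t) ^ n / 2) := by gcongr
        _ = _ := by ring
    have b2 : ‖Ks‖ ≤ (4 * t) ^ n * N / 2 := by
      calc ‖Ks‖ ≤ (N % n : ℕ) * ‖K1‖ := hKsn
        _ ≤ n * t := by gcongr
        _ ≤ (N * (4 * t) ^ (n - 1)) * t := by gcongr
        _ ≤ (N * (4 * t) ^ (n - 1)) * (2 * t) := by gcongr; linarith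
        _ = _ := by rw [epow]; ring
    have p1 : ‖Km * A ^ (N % n)‖ ≤ ‖Km‖ :=
      (norm_mul_le _ _).trans (mul_le_of_le_one_right (norm_nonneg _) (norm_op_pow_le hAn _))
    have p2 : ‖A ^ (n * (N / n)) * Ks‖ ≤ ‖Ks‖ :=
      (norm_mul_le _ _).trans (mul_le_of_le_one_left (norm_nonneg _) (norm_op_pow_le hAn _))
    have := norm_add_le (Km * A ^ (N % n)) (A ^ (n * (N / n)) * Ks)
    linarith
end
end

section
/- For all j, k ∈ ℤ the conjugated operators B^{(j)} = D_n^j B D_n^{−j} and C^{(j)} = D_n^j C D_n^{−j} satisfy: B^{(j)} B^{(k)} = B^{(k)} B^{(j)}, C^{(j)} C^{(k)} = C^{(k)} C^{(j)}, and B^{(j)} C^{(k)} = (C^{(k)})^* B^{(j)}. -/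
noncomputable section

theorem op_ext_aux {S T : Op} (h : ∀ i, S (δ i) = T (δ i)) : S = T := by
  refine ContinuousLinearMap.ext fun f => ?_
  have hf := lp.hasSum_single (p := 2) (by simp) f
  have hS := hf.mapL S
  have hT := hf.mapL T
  have e : (fun i => S (lp.single 2 i (f i))) = fun i => T (lp.single 2 i (f i)) := by
    funext i
    have : (lp.single 2 i (f i) : Hqw) = f i • δ i := by
      unfold δ
      rw [← lp.single_smul]; simp
    rw [this, map_smul, map_smul, h]
  rw [e] at hS
  exact hS.unique hT

theorem op_ext_parity {S T : Op} (h0 : ∀ i, S (δ (2 * i)) = T (δ (2 * i)))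
    (h1 : ∀ i, S (δ (2 * i + 1)) = T (δ (2 * i + 1))) : S = T := by
  apply op_ext_aux
  intro i
  obtain ⟨m, rfl | rfl⟩ := Int.even_or_odd' i
  · exact h0 m
  · exact h1 m

theorem inner_delta (i j : ℤ) : inner ℂ (δ i) (δ j) = if i = j then (1 : ℂ) else 0 := by
  unfold δ
  rw [lp.inner_single_left]
  by_cases h : i = j
  · subst h; simp
  · simp [h]

theorem vec_ext_s9 {f g : Hqw} (h : ∀ i, inner ℂ (δ i) f = inner ℂ (δ i) g) : f = g := by
  ext i
  have := h i
  unfold δ at this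
  rw [lp.inner_single_left, lp.inner_single_left] at this
  simpa using this

theorem conj_zpow_aux {n : ℕ} {α : ℂ} (hα : IsAdmissible n α) (m : ℤ) :
    (starRingEnd ℂ) (α ^ m) = α ^ (-m) := by
  obtain ⟨_, k, _, _, rfl⟩ := hα
  rw [map_zpow₀, ← Complex.exp_conj, zpow_neg, ← inv_zpow, ← Complex.exp_neg, map_mul,
    Complex.conj_ofReal, Complex.conj_I, mul_neg]

theorem adj_even {n : ℕ} {α : ℂ} (hα : IsAdmissible n α) {k : ℤ} {C : Op} (hC : IsCj α k C)
    (i : ℤ) : ContinuousLinearMap.adjoint C (δ (2 * i)) = α ^ (-(2 * k)) • δ (2 * i - 2) := by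
  apply vec_ext_s9
  intro m
  rw [ContinuousLinearMap.adjoint_inner_right]
  obtain ⟨m, rfl | rfl⟩ := Int.even_or_odd' m
  · rw [(hC m).1, inner_smul_left, inner_smul_right, conj_zpow_aux hα, inner_delta, inner_delta]
    congr 2
    apply propext; omega
  · rw [(hC m).2, inner_smul_left, inner_smul_right, inner_delta, inner_delta,
      if_neg (by omega), if_neg (by omega)]
    simp

theorem adj_odd {n : ℕ} {α : ℂ} (hα : IsAdmissible n α) {k : ℤ} {C : Op} (hC : IsCj α k C)
    (i : ℤ) : ContinuousLinearMap.adjoint C (δ (2 * i + 1)) = α ^ (2 * k) • δ (2 * i + 3) := by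
  apply vec_ext_s9
  intro m
  rw [ContinuousLinearMap.adjoint_inner_right]
  obtain ⟨m, rfl | rfl⟩ := Int.even_or_odd' m
  · rw [(hC m).1, inner_smul_left, inner_smul_right, inner_delta, inner_delta,
      if_neg (by omega), if_neg (by omega)]
    simp
  · rw [(hC m).2, inner_smul_left, inner_smul_right, conj_zpow_aux hα, inner_delta, inner_delta,
      neg_neg]
    congr 2
    apply propext; omega

/-- for all `j, k ∈ ℤ`, `B^{(j)} B^{(k)} = B^{(k)} B^{(j)}`,
`C^{(j)} C^{(k)} = C^{(k)} C^{(j)}`, and `B^{(j)} C^{(k)} = (C^{(k)})^* B^{(j)}`. -/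
theorem stmt9 (n : ℕ) (hn : 0 < n) (α : ℂ) (hα : IsAdmissible n α)
    (Bf Cf : ℤ → Op) (hBf : ∀ j : ℤ, IsBj α j (Bf j)) (hCf : ∀ j : ℤ, IsCj α j (Cf j)) :
    ∀ j k : ℤ,
      Bf j * Bf k = Bf k * Bf j ∧
      Cf j * Cf k = Cf k * Cf j ∧
      Bf j * Cf k = ContinuousLinearMap.adjoint (Cf k) * Bf j := by
  intro j k
  refine ⟨op_ext_aux fun i => ?_, op_ext_parity (fun i => ?_) (fun i => ?_),
    op_ext_parity (fun i => ?_) (fun i => ?_)⟩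
  · simp only [mul_apply_eq_comp, hBf k i, hBf j i, map_sub, map_smul, hBf k _,
      hBf j _]
    simp only [sub_add_cancel, add_sub_cancel_right]
    module
  · have a : ∀ l, Cf l (δ (2 * i + 2)) = α ^ (2 * l) • δ (2 * i + 4) := fun l => by
      have := (hCf l (i + 1)).1
      rwa [show 2 * (i + 1) = 2 * i + 2 by ring, show 2 * i + 2 + 2 = 2 * i + 4 by ring] at this
    simp only [mul_apply_eq_comp, (hCf _ i).1, map_smul, a]
    module
  · have a : ∀ l, Cf l (δ (2 * i - 1)) = α ^ (-(2 * l)) • δ (2 * i - 3) := fun l => by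
      have := (hCf l (i - 1)).2
      rwa [show 2 * (i - 1) + 1 = 2 * i - 1 by ring,
        show 2 * (i - 1) - 1 = 2 * i - 3 by ring] at this
    simp only [mul_apply_eq_comp, (hCf _ i).2, map_smul, a]
    module
  · have a := adj_odd hα (hCf k) (i - 1)
    rw [show 2 * (i - 1) + 1 = 2 * i - 1 by ring,
        show 2 * (i - 1) + 3 = 2 * i + 1 by ring] at a
    simp only [mul_apply_eq_comp, (hCf _ i).1, map_smul, map_sub, hBf j _, a,
      adj_odd hα (hCf k) i]
    rw [show 2 * i + 2 - 1 = 2 * i + 1 by ring, show 2 * i + 2 + 1 = 2 * i + 3 by ring]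
    module
  · have a := adj_even hα (hCf k) (i + 1)
    rw [show 2 * (i + 1) = 2 * i + 1 + 1 by ring,
        show 2 * i + 1 + 1 - 2 = 2 * i by ring] at a
    simp only [mul_apply_eq_comp, (hCf _ i).2, map_smul, map_sub, hBf j _, a]
    rw [show 2 * i + 1 - 1 = 2 * i by ring, adj_even hα (hCf k) i,
      show 2 * i - 1 - 1 = 2 * i - 2 by ring, show 2 * i - 1 + 1 = 2 * i by ring]
    module
end
end

section
/- For all 0 ≤ m ≤ ℓ ≤ n the following conjugation formulas hold, where χ = 1 if ℓ ≠ n and χ = 0 if ℓ = n: if m = 0 then D_n·S^{ℓ,0}_{[0,n−1]}·D_n^* = S^{ℓ−1,0}_{[1,n−1]}·B + χ·S^{ℓ,0}_{[1,n−1]}; if 1 ≤ m < ℓ then D_n·S^{ℓ,m}_{[0,n−1]}·D_n^* = S^{ℓ−1,m−1}_{[1,n−1]}·C + S^{ℓ−1,m}_{[1,n−1]}·B + χ·S^{ℓ,m}_{[1,n−1]}; and if m = ℓ ≥ 1 then D_n·S^{ℓ,ℓ}_{[0,n−1]}·D_n^* = S^{ℓ−1,ℓ−1}_{[1,n−1]}·C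 + χ·S^{ℓ,ℓ}_{[1,n−1]}. -/
noncomputable section

lemma coord_eq_inner (f : Hqw) (i : ℤ) : f i = inner ℂ (δ i) f := by
  unfold δ
  rw [lp.inner_single_left]
  simp

lemma op_ext_s15 {T S : Op} (h : ∀ i, T (δ i) = S (δ i)) : T = S := by
  have h2 : ContinuousLinearMap.adjoint T = ContinuousLinearMap.adjoint S := by
    ext g i
    rw [coord_eq_inner, coord_eq_inner, ContinuousLinearMap.adjoint_inner_right,
      ContinuousLinearMap.adjoint_inner_right, h]
  exact ContinuousLinearMap.adjoint.injective h2

lemma adj_apply {α : ℂ} (hα : ‖α‖ = 1) {D : Op} (hD : IsDn α D) (j : ℤ) :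
    ContinuousLinearMap.adjoint D (δ j) = α ^ (-j) • δ j := by
  have hc : ∀ i : ℤ, (starRingEnd ℂ) (α ^ i) = α ^ (-i) := by
    intro i
    rw [map_zpow₀, ← Complex.inv_eq_conj hα, inv_zpow, zpow_neg]
  ext i
  rw [coord_eq_inner, ContinuousLinearMap.adjoint_inner_right, hD, inner_smul_left,
    ← coord_eq_inner, hc]
  rw [lp.coeFn_smul, Pi.smul_apply, smul_eq_mul]
  by_cases h : i = j
  · rw [h]
  · have : (δ j : Hqw) i = 0 := lp.single_apply_ne 2 j 1 h
    rw [this]; simp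

lemma conj_B {α : ℂ} (hα : ‖α‖ = 1) {D : Op} (hD : IsDn α D) {Bf : ℤ → Op}
    (hBf : ∀ j : ℤ, IsBj α j (Bf j)) (j : ℤ) :
    D * Bf j * ContinuousLinearMap.adjoint D = Bf (j + 1) := by
  have h0 : α ≠ 0 := by rintro rfl; simp at hα
  apply op_ext_s15
  intro i
  simp only [mul_apply_eq_comp]
  rw [adj_apply hα hD, map_smul, hBf j i, hBf (j+1) i, map_smul, map_sub, map_smul, map_smul,
    hD, hD, smul_sub, smul_smul, smul_smul, smul_smul, smul_smul]
  simp only [← zpow_add₀ h0]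
  congr 3 <;> ring

lemma conj_C {α : ℂ} (hα : ‖α‖ = 1) {D : Op} (hD : IsDn α D) {Cf : ℤ → Op}
    (hCf : ∀ j : ℤ, IsCj α j (Cf j)) (j : ℤ) :
    D * Cf j * ContinuousLinearMap.adjoint D = Cf (j + 1) := by
  have h0 : α ≠ 0 := by rintro rfl; simp at hα
  apply op_ext_s15
  intro i
  simp only [mul_apply_eq_comp]
  rcases Int.even_or_odd' i with ⟨k, rfl | rfl⟩
  · rw [adj_apply hα hD, map_smul, (hCf j k).1, (hCf (j+1) k).1, map_smul, map_smul,
      hD, smul_smul, smul_smul]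
    simp only [← zpow_add₀ h0]
    congr 2; ring
  · rw [adj_apply hα hD, map_smul, (hCf j k).2, (hCf (j+1) k).2, map_smul, map_smul,
      hD, smul_smul, smul_smul]
    simp only [← zpow_add₀ h0]
    congr 2; ring

lemma adj_mul {α : ℂ} (hα : ‖α‖ = 1) {D : Op} (hD : IsDn α D) :
    ContinuousLinearMap.adjoint D * D = 1 := by
  have h0 : α ≠ 0 := by rintro rfl; simp at hα
  apply op_ext_s15
  intro i
  simp only [mul_apply_eq_comp]
  rw [hD, map_smul, adj_apply hα hD, smul_smul, ← zpow_add₀ h0]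
  simp

lemma mul_adj {α : ℂ} (hα : ‖α‖ = 1) {D : Op} (hD : IsDn α D) :
    D * ContinuousLinearMap.adjoint D = 1 := by
  have h0 : α ≠ 0 := by rintro rfl; simp at hα
  apply op_ext_s15
  intro i
  simp only [mul_apply_eq_comp]
  rw [adj_apply hα hD, map_smul, hD, smul_smul, ← zpow_add₀ h0]
  simp

lemma conj_list (D E : Op) (h1 : E * D = 1) (h2 : D * E = 1) (L : List Op) :
    D * L.prod * E = (L.map fun A => D * A * E).prod := by
  induction L with
  | nil => simpa using h2
  | cons A L ih =>
    rw [List.prod_cons, List.map_cons, List.prod_cons, ← ih]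
    calc D * (A * L.prod) * E = D * A * 1 * L.prod * E := by simp only [mul_assoc, one_mul]
      _ = _ := by rw [← h1]; simp only [mul_assoc]

lemma conj_Sop (D E : Op) (h1 : E * D = 1) (h2 : D * E = 1) (Bf Cf : ℤ → Op)
    (hB : ∀ j, D * Bf j * E = Bf (j + 1)) (hC : ∀ j, D * Cf j * E = Cf (j + 1))
    (a n l m : ℕ) :
    D * Sop Bf Cf a n l m * E = Sop (fun j => Bf (j + 1)) (fun j => Cf (j + 1)) a n l m := by
  unfold Sop
  rw [Finset.mul_sum, Finset.sum_mul]
  refine Finset.sum_congr rfl fun p _ => ?_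
  split_ifs
  · rw [conj_list D E h1 h2, List.map_ofFn]
    congr 2
    funext k
    simp only [Function.comp]
    split_ifs
    · exact hC _
    · exact hB _
  · simp

lemma shift_Sop (Bf Cf : ℤ → Op) (n l m : ℕ) :
    Sop (fun j => Bf (j + 1)) (fun j => Cf (j + 1)) 0 n l m = Sop Bf Cf 1 (n + 1) l m := by
  unfold Sop
  refine Fintype.sum_of_injective
    (fun p : (Fin l → Fin n) × (Fin l → Bool) => ((fun k => (p.1 k).succ, p.2) :
      (Fin l → Fin (n+1)) × (Fin l → Bool))) ?_ _ _ ?_ ?_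
  · rintro ⟨p, e⟩ ⟨q, f⟩ h
    simp only [Prod.mk.injEq] at h
    obtain ⟨h, rfl⟩ := h
    congr 1
    funext k
    exact Fin.succ_injective _ (congrFun h k)
  · rintro ⟨p, e⟩ h
    rw [if_neg]
    rintro ⟨-, ha, -⟩
    apply h
    refine ⟨(fun k => (p k).pred (by have := ha k; intro h0; simp [h0] at this), e), ?_⟩
    simp
  · rintro ⟨p, e⟩
    have hs : StrictMono (fun k => (p k).succ) ↔ StrictMono p := by
      simp [StrictMono]
    simp [hs]

lemma card_last (l : ℕ) (e : Fin (l + 1) → Bool) :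
    (Finset.univ.filter fun k => e k = true).card =
      (Finset.univ.filter fun k : Fin l => e k.castSucc = true).card +
        (if e (Fin.last l) = true then 1 else 0) := by
  simp only [Finset.card_filter, Fin.sum_univ_castSucc]

/-- The summand of `Sop`. -/
noncomputable def prodTerm (Bf Cf : ℤ → Op) {n l : ℕ} (p : Fin l → Fin n) (e : Fin l → Bool) : Op :=
  (List.ofFn fun k : Fin l =>
        if e k = true then Cf ((p k : ℕ) : ℤ) else Bf ((p k : ℕ) : ℤ)).prod

lemma strictMono_snoc_last {n l : ℕ} (p : Fin l → Fin n) :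
    StrictMono (Fin.snoc (fun k => (p k).castSucc) (Fin.last n) : Fin (l+1) → Fin (n+1)) ↔
      StrictMono p := by
  constructor
  · intro h i j hij
    have := h (Fin.castSucc_lt_castSucc_iff.2 hij)
    simpa using this
  · intro h i j hij
    induction j using Fin.lastCases with
    | last =>
      induction i using Fin.lastCases with
      | last => exact absurd hij (lt_irrefl _)
      | cast i => simp [Fin.castSucc_lt_last]
    | cast j =>
      induction i using Fin.lastCases with
      | last => exact absurd hij (not_lt.2 (Fin.le_last _))
      | cast i => simpa using h (Fin.castSucc_lt_castSucc_iff.1 hij)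

lemma prodTerm_snoc (Bf Cf : ℤ → Op) {n l : ℕ} (p : Fin l → Fin n) (e : Fin l → Bool) (b : Bool) :
    prodTerm Bf Cf (Fin.snoc (fun k => (p k).castSucc) (Fin.last n) : Fin (l+1) → Fin (n+1))
      (Fin.snoc e b : Fin (l+1) → Bool) =
      prodTerm Bf Cf p e * (if b = true then Cf n else Bf n) := by
  unfold prodTerm
  rw [List.ofFn_succ', List.concat_eq_append, List.prod_append]
  simp

open Classical in
lemma Sop_succ (Bf Cf : ℤ → Op) (a n l m : ℕ) (ha : a ≤ n) :
    Sop Bf Cf a (n + 1) (l + 1) m =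
      (if m = 0 then 0 else Sop Bf Cf a n l (m - 1) * Cf n) + Sop Bf Cf a n l m * Bf n +
        Sop Bf Cf a n (l + 1) m := by
  let e : ((Fin l → Fin n) × (Fin l → Bool)) × Bool ⊕ (Fin (l+1) → Fin n) × (Fin (l+1) → Bool) →
      (Fin (l+1) → Fin (n+1)) × (Fin (l+1) → Bool) :=
    Sum.elim (fun x => (Fin.snoc (fun k => (x.1.1 k).castSucc) (Fin.last n), Fin.snoc x.1.2 x.2))
      (fun x => (fun k => (x.1 k).castSucc, x.2))
  have he : Function.Injective e := by
    rintro (⟨⟨p, η⟩, b⟩ | ⟨p, η⟩) (⟨⟨p', η'⟩, b'⟩ | ⟨p', η'⟩) h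
    · simp only [e, Sum.elim_inl, Prod.mk.injEq, Fin.snoc_inj] at h
      obtain ⟨⟨h, -⟩, rfl, rfl⟩ := h
      have : p = p' := funext fun k => Fin.castSucc_injective _ (congrFun h k)
      rw [this]
    · simp only [e, Sum.elim_inl, Sum.elim_inr, Prod.mk.injEq] at h
      have := congrFun h.1 (Fin.last l)
      rw [Fin.snoc_last] at this
      exact absurd this.symm (Fin.castSucc_lt_last _).ne
    · simp only [e, Sum.elim_inl, Sum.elim_inr, Prod.mk.injEq] at h
      have := congrFun h.1 (Fin.last l)
      rw [Fin.snoc_last] at this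
      exact absurd this (Fin.castSucc_lt_last _).ne
    · simp only [e, Sum.elim_inr, Prod.mk.injEq] at h
      obtain ⟨h, rfl⟩ := h
      have : p = p' := funext fun k => Fin.castSucc_injective _ (congrFun h k)
      rw [this]
  have key := Fintype.sum_of_injective e he
    (fun x => if StrictMono (e x).1 ∧ (∀ k, a ≤ ((e x).1 k : ℕ)) ∧
        (Finset.univ.filter fun k => (e x).2 k = true).card = m then
          prodTerm Bf Cf (e x).1 (e x).2 else 0)
    (fun x => if StrictMono x.1 ∧ (∀ k, a ≤ (x.1 k : ℕ)) ∧
        (Finset.univ.filter fun k => x.2 k = true).card = m then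
          prodTerm Bf Cf x.1 x.2 else 0) ?_ (fun _ => rfl)
  · have hL : Sop Bf Cf a (n + 1) (l + 1) m = _ := key.symm
    rw [hL, Fintype.sum_sum_type, Fintype.sum_prod_type_right, Fintype.sum_bool]
    congr 1
    · congr 1
      · split_ifs with hm
        · apply Finset.sum_eq_zero
          intro x _
          rw [if_neg]
          rintro ⟨-, -, h⟩
          rw [card_last] at h
          simp [e] at h
          omega
        · unfold Sop
          rw [Finset.sum_mul]
          refine Finset.sum_congr rfl fun x _ => ?_
          have hm' : ∀ c, c + 1 = m ↔ c = m - 1 := by omega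
          rw [card_last]
          simp only [e, Sum.elim_inl, strictMono_snoc_last, prodTerm_snoc,
            Fin.forall_fin_succ', Fin.snoc_castSucc, Fin.snoc_last, Fin.val_castSucc,
            Fin.val_last, ha, and_true, if_true, hm', ite_mul, zero_mul]
          rfl
      · unfold Sop
        rw [Finset.sum_mul]
        refine Finset.sum_congr rfl fun x _ => ?_
        rw [card_last]
        simp only [e, Sum.elim_inl, strictMono_snoc_last, prodTerm_snoc,
          Fin.forall_fin_succ', Fin.snoc_castSucc, Fin.snoc_last, Fin.val_castSucc,
          Fin.val_last, ha, and_true, ite_mul, zero_mul, Bool.false_eq_true, if_false, add_zero]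
        rfl
  · rintro ⟨p, η⟩ h
    rw [if_neg]
    rintro ⟨hp, -, -⟩
    apply h
    have hlt : ∀ k : Fin l, p k.castSucc ≠ Fin.last n := fun k =>
      ((hp (Fin.castSucc_lt_last k)).trans_le (Fin.le_last _)).ne
    by_cases hl : p (Fin.last l) = Fin.last n
    · refine ⟨Sum.inl ((fun k => (p k.castSucc).castPred (hlt k), fun k => η k.castSucc),
        η (Fin.last l)), ?_⟩
      simp only [e, Sum.elim_inl, Fin.castSucc_castPred, ← hl]
      exact Prod.ext (Fin.snoc_init_self p) (Fin.snoc_init_self η)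
    · have hlt' : ∀ k, p k ≠ Fin.last n := by
        intro k
        induction k using Fin.lastCases with
        | last => exact hl
        | cast k => exact hlt k
      refine ⟨Sum.inr (fun k => (p k).castPred (hlt' k), η), ?_⟩
      simp [e]

lemma Sop_card (Bf Cf : ℤ → Op) (a n l m : ℕ) (h : l < m) : Sop Bf Cf a n l m = 0 := by
  unfold Sop
  apply Finset.sum_eq_zero
  intro x _
  rw [if_neg]
  rintro ⟨-, -, h'⟩
  have := Finset.card_le_univ (Finset.univ.filter fun k => x.2 k = true)
  rw [Fintype.card_fin] at this
  omega

lemma Sop_full (Bf Cf : ℤ → Op) (n m : ℕ) (hn : 0 < n) : Sop Bf Cf 1 n n m = 0 := by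
  unfold Sop
  apply Finset.sum_eq_zero
  intro x _
  rw [if_neg]
  rintro ⟨h, ha, -⟩
  have hs := Finite.surjective_of_injective h.injective
  obtain ⟨k, hk⟩ := hs ⟨0, hn⟩
  have := ha k
  rw [hk] at this
  simp at this

/-- Lemma 5.2, conjugation: with `χ = 1` if `ℓ ≠ n` and `χ = 0`
otherwise: `D_n S^{ℓ,0}_{[0,n-1]} D_n^* = S^{ℓ-1,0}_{[1,n-1]} B + χ S^{ℓ,0}_{[1,n-1]}`
for `1 ≤ ℓ`; `D_n S^{ℓ,m}_{[0,n-1]} D_n^* = S^{ℓ-1,m-1}_{[1,n-1]} C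
+ S^{ℓ-1,m}_{[1,n-1]} B + χ S^{ℓ,m}_{[1,n-1]}` for `1 ≤ m < ℓ`; and
`D_n S^{ℓ,ℓ}_{[0,n-1]} D_n^* = S^{ℓ-1,ℓ-1}_{[1,n-1]} C + χ S^{ℓ,ℓ}_{[1,n-1]}` for `1 ≤ ℓ`. -/
theorem stmt15 (n : ℕ) (hn : 0 < n) (α : ℂ) (hα : IsAdmissible n α)
    (Bf Cf : ℤ → Op) (hBf : ∀ j : ℤ, IsBj α j (Bf j)) (hCf : ∀ j : ℤ, IsCj α j (Cf j))
    (B C : Op) (hB : IsB B) (hC : IsC C)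
    (D : Op) (hD : IsDn α D)
    (l m : ℕ) (hm : m ≤ l) (hl : l ≤ n) :
    (m = 0 → 1 ≤ l →
      D * Sop Bf Cf 0 n l 0 * ContinuousLinearMap.adjoint D =
        Sop Bf Cf 1 n (l - 1) 0 * B + (if l ≠ n then Sop Bf Cf 1 n l 0 else 0)) ∧
    (1 ≤ m → m < l →
      D * Sop Bf Cf 0 n l m * ContinuousLinearMap.adjoint D =
        Sop Bf Cf 1 n (l - 1) (m - 1) * C + Sop Bf Cf 1 n (l - 1) m * B +
          (if l ≠ n then Sop Bf Cf 1 n l m else 0)) ∧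
    (m = l → 1 ≤ l →
      D * Sop Bf Cf 0 n l l * ContinuousLinearMap.adjoint D =
        Sop Bf Cf 1 n (l - 1) (l - 1) * C + (if l ≠ n then Sop Bf Cf 1 n l l else 0)) := by
  obtain ⟨-, k, -, -, hk⟩ := hα
  have hα1 : ‖α‖ = 1 := by rw [hk, Complex.norm_exp_ofReal_mul_I]
  have h0 : α ≠ 0 := by rintro rfl; simp at hα1
  have hαn : α ^ n = 1 := by
    rw [hk, ← Complex.exp_nat_mul, Complex.exp_eq_one_iff]
    refine ⟨k, ?_⟩
    have : (n : ℂ) ≠ 0 := by exact_mod_cast hn.ne'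
    push_cast
    field_simp
  have hBn : Bf n = B := by
    apply op_ext_s15
    intro i
    rw [hBf n i, hB i]
    simp [hαn]
  have hCn : Cf n = C := by
    have h2 : α ^ (2 * (n : ℤ)) = 1 := by
      rw [mul_comm, zpow_mul, zpow_natCast, hαn, one_zpow]
    apply op_ext_s15
    intro i
    rcases Int.even_or_odd' i with ⟨k, rfl | rfl⟩
    · rw [(hCf n k).1, (hC k).1, h2, one_smul]
    · rw [(hCf n k).2, (hC k).2, zpow_neg, h2, inv_one, one_smul]
  have main : ∀ m, 1 ≤ l → D * Sop Bf Cf 0 n l m * ContinuousLinearMap.adjoint D =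
      (if m = 0 then 0 else Sop Bf Cf 1 n (l - 1) (m - 1) * C) + Sop Bf Cf 1 n (l - 1) m * B +
          (if l ≠ n then Sop Bf Cf 1 n l m else 0) := by
    intro m h1
    obtain ⟨l, rfl⟩ : ∃ l', l = l' + 1 := ⟨l - 1, by omega⟩
    rw [conj_Sop D _ (adj_mul hα1 hD) (mul_adj hα1 hD) Bf Cf (conj_B hα1 hD hBf)
      (conj_C hα1 hD hCf), shift_Sop, Sop_succ Bf Cf 1 n l m hn, hBn, hCn]
    congr 1
    split_ifs with hln
    · rfl
    · have hln' : l + 1 = n := not_not.1 hln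
      rw [hln', Sop_full _ _ _ _ hn]
  refine ⟨fun _ h1 => ?_, fun h1 h2 => ?_, fun _ h1 => ?_⟩
  · rw [main 0 h1]; simp
  · rw [main m (by omega), if_neg (by omega)]
  · rw [main l h1, if_neg (by omega), Sop_card Bf Cf 1 n (l - 1) l (by omega), zero_mul, add_zero]
end
end

section
/- For all 1 ≤ m ≤ ℓ ≤ n, the operator S^{ℓ,m}_{[0,n−1]} commutes with D_n if and only if [C, S^{ℓ−1,m−1}_{[1,n−1]}] + [B, S^{ℓ−1,m}_{[1,n−1]}] = 0. -/
noncomputable section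

/-- recursive version of the elementary symmetric polynomial, over a list of pairs. -/
def Erec : List (Op × Op) → ℕ → ℕ → Op
  | [], 0, 0 => 1
  | [], 0, _ + 1 => 0
  | [], _ + 1, _ => 0
  | _ :: L, 0, m => Erec L 0 m
  | x :: L, l + 1, 0 => Erec L (l + 1) 0 + x.1 * Erec L l 0
  | x :: L, l + 1, m + 1 => Erec L (l + 1) (m + 1) + x.1 * Erec L l (m + 1) + x.2 * Erec L l m

theorem Erec_zero (L : List (Op × Op)) (m : ℕ) : Erec L 0 m = Erec [] 0 m := by
  induction L with
  | nil => rfl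
  | cons x L ih => simpa [Erec] using ih

theorem Erec_snoc (L : List (Op × Op)) (x : Op × Op) (l : ℕ) :
    Erec (L ++ [x]) (l + 1) 0 = Erec L (l + 1) 0 + Erec L l 0 * x.1 ∧
    ∀ m, Erec (L ++ [x]) (l + 1) (m + 1) =
      Erec L (l + 1) (m + 1) + Erec L l (m + 1) * x.1 + Erec L l m * x.2 := by
  induction L generalizing l with
  | nil =>
    cases l with
    | zero =>
      refine ⟨by simp [Erec], fun m => ?_⟩
      cases m <;> simp [Erec]
    | succ l => exact ⟨by simp [Erec], fun m => by simp [Erec]⟩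
  | cons y L ih =>
    cases l with
    | zero =>
      have h := ih 0
      refine ⟨?_, fun m => ?_⟩
      · simp only [List.cons_append, Erec, h.1, Erec_zero (L ++ [x]), Erec_zero L]
        simp only [mul_one, one_mul]; abel
      · simp only [List.cons_append, Erec, h.2, Erec_zero (L ++ [x]), Erec_zero L]
        cases m <;> simp only [Erec, mul_one, one_mul, mul_zero, zero_mul] <;> abel
    | succ l =>
      have h := ih (l + 1)
      have h' := ih l
      refine ⟨?_, fun m => ?_⟩
      · simp only [List.cons_append, Erec, h.1, h'.1, mul_add, add_mul, mul_assoc]; abel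
      · cases m with
        | zero => 
          simp only [List.cons_append, Erec, h.2, h'.2, h'.1, mul_add, add_mul, mul_assoc]; abel
        | succ m =>
          simp only [List.cons_append, Erec, h.2, h'.2, h'.1, mul_add, add_mul, mul_assoc]; abel

theorem Erec_conj (D : Op) (f g : ℤ → Op × Op) 
    (h1 : ∀ j, D * (f j).1 = (g j).1 * D) (h2 : ∀ j, D * (f j).2 = (g j).2 * D)
    (L : List ℤ) (l m : ℕ) :
    D * Erec (L.map f) l m = Erec (L.map g) l m * D := by
  induction L generalizing l m with
  | nil => 
    cases l <;> cases m <;> simp [Erec]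
  | cons j L ih =>
    cases l with
    | zero => simpa [Erec] using ih 0 m
    | succ l =>
      cases m with
      | zero =>
        simp only [List.map_cons, Erec, mul_add, add_mul, ih, ← mul_assoc, h1]
        rw [mul_assoc, ih, mul_assoc]
      | succ m => 
        simp only [List.map_cons, Erec, mul_add, add_mul, ih, ← mul_assoc, h1, h2]
        rw [mul_assoc _ D, mul_assoc _ D, ih, ih, mul_assoc, mul_assoc]

theorem strictMono_cons_iff {n l : ℕ} (x : Fin n) (y : Fin l → Fin n) :
    StrictMono (Fin.cons x y : Fin (l + 1) → Fin n) ↔ (∀ k, x < y k) ∧ StrictMono y := by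
  constructor
  · intro h
    refine ⟨fun k => ?_, fun i j hij => ?_⟩
    · simpa using h (Fin.succ_pos k)
    · simpa using h (Fin.succ_lt_succ_iff.mpr hij)
  · rintro ⟨h1, h2⟩ i j hij
    induction i using Fin.cases with
    | zero =>
      induction j using Fin.cases with
      | zero => exact absurd hij (lt_irrefl _)
      | succ j => simpa using h1 j
    | succ i =>
      induction j using Fin.cases with
      | zero => exact absurd hij (by simp)
      | succ j => simpa using h2 (Fin.succ_lt_succ_iff.mp hij)

theorem card_filter_cons {l : ℕ} (e : Bool) (η : Fin l → Bool) :
    (Finset.univ.filter fun k => (Fin.cons e η : Fin (l + 1) → Bool) k = true).card =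
      e.toNat + (Finset.univ.filter fun k => η k = true).card := by
  rw [Finset.card_filter, Finset.card_filter, Fin.sum_univ_succ]
  cases e <;> simp

open Classical in
/-- words starting at `a` -/
theorem Sop_first (Bf Cf : ℤ → Op) (a n l m : ℕ) (ha : a < n) :
    Sop Bf Cf a n (l + 1) m = Sop Bf Cf (a + 1) n (l + 1) m +
      ∑ e : Bool, (if e = true then Cf a else Bf a) *
        ∑ p : (Fin l → Fin n) × (Fin l → Bool),
        if StrictMono p.1 ∧ (∀ k, a + 1 ≤ (p.1 k : ℕ)) ∧
          e.toNat + (Finset.univ.filter fun k => p.2 k = true).card = m then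
        (List.ofFn fun k : Fin l =>
          if p.2 k = true then Cf ((p.1 k : ℕ) : ℤ) else Bf ((p.1 k : ℕ) : ℤ)).prod
        else 0 := by
  have key : ∀ q : (Fin (l + 1) → Fin n) × (Fin (l + 1) → Bool),
      (StrictMono q.1 ∧ (∀ k, a ≤ (q.1 k : ℕ)) ∧
        (Finset.univ.filter fun k => q.2 k = true).card = m) ↔
      ((StrictMono q.1 ∧ (∀ k, a + 1 ≤ (q.1 k : ℕ)) ∧
        (Finset.univ.filter fun k => q.2 k = true).card = m) ∨ 
       ((StrictMono q.1 ∧ (Finset.univ.filter fun k => q.2 k = true).card = m) ∧ 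
         (q.1 0 : ℕ) = a)) := by
    intro q
    constructor
    · rintro ⟨h1, h2, h3⟩
      by_cases h : (q.1 0 : ℕ) = a
      · exact Or.inr ⟨⟨h1, h3⟩, h⟩
      · refine Or.inl ⟨h1, fun k => ?_, h3⟩
        have := h2 0
        have h4 : (q.1 0 : ℕ) ≤ q.1 k := h1.monotone (Fin.zero_le k)
        omega
    · rintro (⟨h1, h2, h3⟩ | ⟨⟨h1, h3⟩, h⟩)
      · exact ⟨h1, fun k => by have := h2 k; omega, h3⟩
      · refine ⟨h1, fun k => ?_, h3⟩
        have h4 : (q.1 0 : ℕ) ≤ q.1 k := h1.monotone (Fin.zero_le k)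
        omega
  have split : Sop Bf Cf a n (l + 1) m = Sop Bf Cf (a + 1) n (l + 1) m +
      ∑ q : (Fin (l + 1) → Fin n) × (Fin (l + 1) → Bool),
        if (StrictMono q.1 ∧ (Finset.univ.filter fun k => q.2 k = true).card = m) ∧ 
         (q.1 0 : ℕ) = a then
        (List.ofFn fun k : Fin (l + 1) =>
          if q.2 k = true then Cf ((q.1 k : ℕ) : ℤ) else Bf ((q.1 k : ℕ) : ℤ)).prod
        else 0 := by
    unfold Sop
    rw [← Finset.sum_add_distrib]
    refine Finset.sum_congr rfl fun q _ => ?_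
    rw [if_congr (key q) rfl rfl]
    by_cases h1 : (StrictMono q.1 ∧ (∀ k, a + 1 ≤ (q.1 k : ℕ)) ∧
        (Finset.univ.filter fun k => q.2 k = true).card = m)
    · have h2 : ¬ ((StrictMono q.1 ∧ (Finset.univ.filter fun k => q.2 k = true).card = m) ∧ 
         (q.1 0 : ℕ) = a) := by
        rintro ⟨_, h⟩
        have := h1.2.1 0
        omega
      rw [if_pos (Or.inl h1), if_pos h1, if_neg h2, add_zero]
    · rw [if_neg h1, zero_add]
      exact if_congr (or_iff_right h1) rfl rfl
  rw [split]
  congr 1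
  rw [Fintype.sum_prod_type]
  rw [← (Fin.consEquiv fun _ : Fin (l + 1) => Fin n).sum_comp, Fintype.sum_prod_type]
  rw [Finset.sum_eq_single (⟨a, ha⟩ : Fin n)]
  · simp_rw [← (Fin.consEquiv fun _ : Fin (l + 1) => Bool).sum_comp, Fintype.sum_prod_type,
      Finset.mul_sum]
    rw [Finset.sum_comm]
    refine Finset.sum_congr rfl fun e _ => Finset.sum_congr rfl fun y _ =>
      Finset.sum_congr rfl fun η _ => ?_
    simp only [Fin.consEquiv_apply, strictMono_cons_iff, card_filter_cons, Fin.cons_zero,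
      List.ofFn_succ, Fin.cons_succ, List.prod_cons, mul_ite, mul_zero]
    refine if_congr ?_ rfl rfl
    have hs : StrictMono ((Fin.consEquiv fun _ : Fin (l + 1) => Fin n) (⟨a, ha⟩, y)) ↔ _ :=
      strictMono_cons_iff (⟨a, ha⟩ : Fin n) y
    rw [hs]
    simp only [Fin.lt_def, Nat.succ_le_iff]
    tauto
  · intro x _ hx
    refine Finset.sum_eq_zero fun y _ => Finset.sum_eq_zero fun η _ => if_neg ?_
    rintro ⟨_, h⟩
    exact hx (Fin.ext (by simpa using h))
  · simp

theorem Sop_zero (Bf Cf : ℤ → Op) (a n m : ℕ) : Sop Bf Cf a n 0 m = Erec [] 0 m := by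
  cases m <;> simp [Sop, Erec, Subsingleton.strictMono]

theorem Sop_top (Bf Cf : ℤ → Op) (n l m : ℕ) : Sop Bf Cf n n (l + 1) m = 0 := by
  unfold Sop
  refine Finset.sum_eq_zero fun p _ => if_neg ?_
  rintro ⟨_, h, _⟩
  have := h 0
  have := (p.1 0).isLt
  omega

theorem Sop_first_zero (Bf Cf : ℤ → Op) (a n l : ℕ) (ha : a < n) :
    Sop Bf Cf a n (l + 1) 0 = Sop Bf Cf (a + 1) n (l + 1) 0 + Bf a * Sop Bf Cf (a + 1) n l 0 := by
  rw [Sop_first _ _ _ _ _ _ ha]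
  simp [Sop]

theorem Sop_first_succ (Bf Cf : ℤ → Op) (a n l m : ℕ) (ha : a < n) :
    Sop Bf Cf a n (l + 1) (m + 1) = Sop Bf Cf (a + 1) n (l + 1) (m + 1)
      + Bf a * Sop Bf Cf (a + 1) n l (m + 1) + Cf a * Sop Bf Cf (a + 1) n l m := by
  rw [Sop_first _ _ _ _ _ _ ha]
  simp only [Sop, Fintype.sum_bool, Bool.toNat_true, Bool.toNat_false, zero_add, 
    add_comm 1, Nat.add_right_cancel_iff, if_true, Bool.false_eq_true, if_false]
  abel

/-- the integers `a, …, a + d - 1` -/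
def seg (a d : ℕ) : List ℤ := (List.range' a d).map (fun j : ℕ => (j : ℤ))

theorem Sop_eq (Bf Cf : ℤ → Op) (d a l m : ℕ) :
    Sop Bf Cf a (a + d) l m = Erec ((seg a d).map fun j => (Bf j, Cf j)) l m := by
  induction d generalizing a l m with
  | zero =>
    cases l with
    | zero => rw [Sop_zero, Erec_zero (List.map _ _)]
    | succ l => simp [Sop_top, seg, Erec]
  | succ d ih =>
    have hs : seg a (d + 1) = (a : ℤ) :: seg (a + 1) d := by simp [seg, List.range'_succ]
    have ih' : ∀ l m, Sop Bf Cf (a + 1) (a + (d + 1)) l m =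
        Erec ((seg (a + 1) d).map fun j => (Bf j, Cf j)) l m := fun l m => by
      rw [← ih (a + 1) l m]; congr 1; omega
    cases l with
    | zero => rw [Sop_zero, Erec_zero (List.map _ _)]
    | succ l =>
      cases m with
      | zero => rw [Sop_first_zero _ _ _ _ _ (by omega), hs, ih', ih']; rfl
      | succ m => rw [Sop_first_succ _ _ _ _ _ _ (by omega), hs, ih', ih', ih']; rfl

theorem Op_ext {S T : Op} (h : ∀ j, S (δ j) = T (δ j)) : S = T := by
  ext1 x
  have hx := lp.hasSum_single (p := 2) (by norm_num) x
  have h1 := hx.mapL S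
  have h2 := hx.mapL T
  refine h1.unique ?_
  convert h2 using 2 with i
  have : lp.single 2 i (x i) = (x i) • δ i := by
    rw [δ, ← lp.single_smul]; simp
  rw [this, map_smul, map_smul, h]

theorem Op_ext_parity {S T : Op} (h : ∀ j, S (δ (2 * j)) = T (δ (2 * j)))
    (h' : ∀ j, S (δ (2 * j + 1)) = T (δ (2 * j + 1))) : S = T := by
  refine Op_ext fun j => ?_
  rcases Int.even_or_odd' j with ⟨k, rfl | rfl⟩
  · exact h k
  · exact h' k

theorem stmt17 (n : ℕ) (hn : 0 < n) (α : ℂ) (hα : IsAdmissible n α)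
    (Bf Cf : ℤ → Op) (hBf : ∀ j : ℤ, IsBj α j (Bf j)) (hCf : ∀ j : ℤ, IsCj α j (Cf j))
    (B C : Op) (hB : IsB B) (hC : IsC C)
    (D : Op) (hD : IsDn α D)
    (l m : ℕ) (hm1 : 1 ≤ m) (hm : m ≤ l) (hl : l ≤ n) :
    Sop Bf Cf 0 n l m * D = D * Sop Bf Cf 0 n l m ↔
      (C * Sop Bf Cf 1 n (l - 1) (m - 1) - Sop Bf Cf 1 n (l - 1) (m - 1) * C) +
        (B * Sop Bf Cf 1 n (l - 1) m - Sop Bf Cf 1 n (l - 1) m * B) = 0 := by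
  obtain ⟨_, k, _, _, hk⟩ := hα
  have α0 : α ≠ 0 := by rw [hk]; exact Complex.exp_ne_zero _
  have αn : α ^ n = 1 := by
    rw [hk, ← Complex.exp_nat_mul, Complex.exp_eq_one_iff]
    refine ⟨k, ?_⟩
    have : (n : ℂ) ≠ 0 := by exact_mod_cast hn.ne'
    push_cast
    field_simp
  have hB0 : Bf 0 = B := Op_ext fun j => by rw [hBf 0 j, hB j]; simp
  have hC0 : Cf 0 = C := Op_ext_parity (fun j => by rw [(hCf 0 j).1, (hC j).1]; simp)
    (fun j => by rw [(hCf 0 j).2, (hC j).2]; simp)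
  have hBn : Bf n = B := Op_ext fun j => by rw [hBf n j, hB j]; simp [αn]
  have αn2 : α ^ (2 * (n : ℤ)) = 1 := by
    rw [mul_comm, zpow_mul, zpow_natCast, αn, one_zpow]
  have hCn : Cf n = C := Op_ext_parity
    (fun j => by rw [(hCf n j).1, (hC j).1, αn2, one_smul])
    (fun j => by rw [(hCf n j).2, (hC j).2, zpow_neg, αn2, inv_one, one_smul])
  have cB : ∀ j, D * Bf j = Bf (j + 1) * D := fun j => Op_ext fun i => by
    simp only [mul_apply_eq_comp, hD i, hBf j i, map_sub, map_smul, hD (i - 1),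
      hD (i + 1), hBf (j + 1) i, smul_sub, smul_smul, ← zpow_add₀ α0]
    congr 3 <;> ring
  have cC : ∀ j, D * Cf j = Cf (j + 1) * D := fun j => Op_ext_parity 
    (fun i => by
      simp only [mul_apply_eq_comp, hD (2 * i), (hCf j i).1, map_smul, hD (2 * i + 2),
        (hCf (j + 1) i).1, smul_smul, ← zpow_add₀ α0]
      congr 2; ring)
    (fun i => by
      simp only [mul_apply_eq_comp, hD (2 * i + 1), (hCf j i).2, map_smul, 
        hD (2 * i - 1), (hCf (j + 1) i).2, smul_smul, ← zpow_add₀ α0]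
      congr 2; ring)
  have cancel : ∀ S T : Op, S * D = T * D ↔ S = T := fun S T => by
    refine ⟨fun h => Op_ext fun j => ?_, fun h => by rw [h]⟩
    have := congrArg (fun R : Op => R (δ j)) h
    simp only [mul_apply_eq_comp, hD j, map_smul] at this
    exact smul_right_injective _ (zpow_ne_zero j α0) this
  obtain ⟨n, rfl⟩ : ∃ d, n = d + 1 := ⟨n - 1, by omega⟩
  obtain ⟨m, rfl⟩ : ∃ d, m = d + 1 := ⟨m - 1, by omega⟩
  obtain ⟨l, rfl⟩ : ∃ d, l = d + 1 := ⟨l - 1, by omega⟩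
  simp only [Nat.add_sub_cancel]
  have e1 : ∀ l m, Sop Bf Cf 1 (n + 1) l m = Erec ((seg 1 n).map fun j => (Bf j, Cf j)) l m := by
    intro l m
    rw [← Sop_eq, add_comm 1 n]
  have shift : D * Sop Bf Cf 0 (n + 1) (l + 1) (m + 1) =
      (Sop Bf Cf 1 (n + 1) (l + 1) (m + 1) + Sop Bf Cf 1 (n + 1) l (m + 1) * B
        + Sop Bf Cf 1 (n + 1) l m * C) * D := by
    have h0 := Sop_eq Bf Cf (n + 1) 0 (l + 1) (m + 1)
    rw [zero_add] at h0
    rw [h0, Erec_conj D _ (fun j => (Bf (j + 1), Cf (j + 1))) cB cC]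
    congr 1
    have : (seg 0 (n + 1)).map (fun j => (Bf (j + 1), Cf (j + 1))) =
        (seg 1 n).map (fun j => (Bf j, Cf j)) ++ [(B, C)] := by
      have h2 : seg 1 (n + 1) = seg 1 n ++ [((n + 1 : ℕ) : ℤ)] := by
        simp [seg, List.range'_concat, add_comm]
      have h3 : seg 1 (n + 1) = (seg 0 (n + 1)).map (fun j => j + 1) := by
        have : List.range' 1 (n + 1) = (List.range' 0 (n + 1)).map (fun j => j + 1) := by
          simpa [add_comm] using (List.map_add_range' (a := 1) 0 (n + 1) 1).symm
        simp [seg, this]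
      have h4 := congrArg (List.map fun j => (Bf j, Cf j)) (h3.symm.trans h2)
      rw [List.map_map, List.map_append] at h4
      simp only [List.map_cons, List.map_nil, hBn, hCn] at h4
      exact h4
    rw [this, (Erec_snoc _ _ _).2, e1, e1, e1]
  rw [shift, cancel, Sop_first_succ _ _ _ _ _ _ (by omega)]
  simp only [Nat.cast_zero, hB0, hC0, zero_add]
  rw [← sub_eq_zero]
  refine Eq.congr ?_ rfl
  abel
end
end
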